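/- arXiv:0906.4873 — 3 statements merged into one kernel-verified Lean document; each statement's English description precedes it below -/
import Mathlib

section
/- Let k be an algebraically closed field of characteristic zero. Then every binomial ideal I ⊆ k[x₁,…,xₙ] admits a primary decomposition into binomial ideals: there exist finitely many primary ideals Q₁,…,Q_r, each of which is a binomial ideal, with I = Q₁ ∩ ⋯ ∩ Q_r. -/
open MvPolynomial

/-- A binomial is a polynomial with at most two terms. -/
def IsBinomial {k : Type*} [CommSemiring k] {n : ℕ} (f : MvPolynomial (Fin n) k) : Prop :=
  f.support.card ≤ 2

/-- A binomial ideal is an ideal generated by binomials. -/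
def IsBinomialIdeal {k : Type*} [CommSemiring k] {n : ℕ}
    (I : Ideal (MvPolynomial (Fin n) k)) : Prop :=
  ∃ S : Set (MvPolynomial (Fin n) k), (∀ f ∈ S, IsBinomial f) ∧ I = Ideal.span S

namespace BinPD

section basics
variable {k : Type*} [Field k] {n : ℕ}

/-- The monic monomial with exponent `a`. -/
noncomputable abbrev M (k : Type*) [Field k] {n : ℕ} (a : Fin n →₀ ℕ) : MvPolynomial (Fin n) k :=
  monomial a (1 : k)

lemma M_add (a b : Fin n →₀ ℕ) : M k (a + b) = M k a * M k b := by
  simp [M, monomial_mul]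

lemma M_nsmul (j : ℕ) (a : Fin n →₀ ℕ) : M k (j • a) = M k a ^ j := by
  simp [M, monomial_pow]

lemma mon_eq (a : Fin n →₀ ℕ) (c : k) : monomial a c = C c * M k a := by
  simp [M, C_mul_monomial]

lemma M_zero : M k (0 : Fin n →₀ ℕ) = 1 := rfl

/-- Congruence of exponents modulo an ideal. -/
def Cg (I : Ideal (MvPolynomial (Fin n) k)) (a b : Fin n →₀ ℕ) : Prop :=
  ∃ c : k, c ≠ 0 ∧ M k a - C c * M k b ∈ I

/-- Nonzerodivisor modulo an ideal. -/
def Nz {R : Type*} [CommRing R] (I : Ideal R) (f : R) : Prop := ∀ g, f * g ∈ I → g ∈ I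

lemma mem1 {R : Type*} [CommRing R] {I : Ideal R} {A X : R} (hA : A ∈ I) (p : R)
    (h : X = p * A) : X ∈ I := h ▸ I.mul_mem_left p hA

lemma mem2 {R : Type*} [CommRing R] {I : Ideal R} {A B X : R} (hA : A ∈ I) (hB : B ∈ I) (p q : R)
    (h : X = p * A + q * B) : X ∈ I :=
  h ▸ I.add_mem (I.mul_mem_left p hA) (I.mul_mem_left q hB)

lemma Nz.mul {R : Type*} [CommRing R] {I : Ideal R} {f g : R} (hf : Nz I f) (hg : Nz I g) :
    Nz I (f * g) := fun h hh => hg _ (hf _ (by rwa [← mul_assoc]))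

lemma Nz.of_mul_left {R : Type*} [CommRing R] {I : Ideal R} {f g : R} (h : Nz I (f * g)) :
    Nz I f := fun x hx => h _ (mem1 hx g (by ring))

lemma Nz.pow {R : Type*} [CommRing R] {I : Ideal R} {f : R} (hf : Nz I f) (j : ℕ) :
    Nz I (f ^ j) := by
  induction j with
  | zero => intro g hg; simpa using hg
  | succ j ih => rw [pow_succ]; exact ih.mul hf

variable {I : Ideal (MvPolynomial (Fin n) k)}

lemma C_mul_mem_iff {c : k} (hc : c ≠ 0) {f : MvPolynomial (Fin n) k} : C c * f ∈ I ↔ f ∈ I := by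
  refine ⟨fun h => mem1 h (C c⁻¹) ?_, fun h => I.mul_mem_left _ h⟩
  rw [← mul_assoc, ← C_mul, inv_mul_cancel₀ hc, C_1, one_mul]

lemma CC {c : k} (hc : c ≠ 0) : (C c⁻¹ : MvPolynomial (Fin n) k) * C c = 1 := by
  rw [← C_mul, inv_mul_cancel₀ hc, C_1]

lemma Cg.refl (a : Fin n →₀ ℕ) : Cg I a a := ⟨1, one_ne_zero, by simp⟩

lemma Cg.symm {a b : Fin n →₀ ℕ} (h : Cg I a b) : Cg I b a := by
  obtain ⟨c, hc, h⟩ := h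
  refine ⟨c⁻¹, inv_ne_zero hc, mem1 h (- C c⁻¹) ?_⟩
  linear_combination (-M k b) * CC (n := n) hc

lemma Cg.trans {a b d : Fin n →₀ ℕ} (h : Cg I a b) (h' : Cg I b d) : Cg I a d := by
  obtain ⟨c, hc, h⟩ := h
  obtain ⟨c', hc', h'⟩ := h'
  refine ⟨c * c', mul_ne_zero hc hc', mem2 h h' 1 (C c) ?_⟩
  rw [C_mul]; ring

lemma Cg.add {a b a' b' : Fin n →₀ ℕ} (h : Cg I a b) (h' : Cg I a' b') :
    Cg I (a + a') (b + b') := by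
  obtain ⟨c, hc, h⟩ := h
  obtain ⟨c', hc', h'⟩ := h'
  refine ⟨c * c', mul_ne_zero hc hc', mem2 h h' (M k a') (C c * M k b) ?_⟩
  rw [C_mul, M_add, M_add]; ring

lemma Cg.cancel {a b u : Fin n →₀ ℕ} (hu : Nz I (M k u)) (h : Cg I (u + a) (u + b)) :
    Cg I a b := by
  obtain ⟨c, hc, h⟩ := h
  refine ⟨c, hc, hu _ (mem1 h 1 ?_)⟩
  rw [M_add, M_add]; ring

lemma Cg.mem {a b : Fin n →₀ ℕ} (h : Cg I a b) (hb : M k b ∈ I) : M k a ∈ I := by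
  obtain ⟨c, hc, h⟩ := h
  exact mem2 h hb 1 (C c) (by ring)

/-- Polynomials of the form `c x^a + d x^b`. -/
def Bin (k : Type*) [Field k] (n : ℕ) : Set (MvPolynomial (Fin n) k) :=
  {f | ∃ a b c d, f = monomial a c + monomial b d}

lemma isBinomial_of_mem_Bin {f : MvPolynomial (Fin n) k} (h : f ∈ Bin k n) : IsBinomial f := by
  classical
  obtain ⟨a, b, c, d, rfl⟩ := h
  unfold IsBinomial
  refine (Finset.card_le_card support_add).trans ((Finset.card_union_le _ _).trans ?_)
  have h1 : (monomial a c).support.card ≤ 1 := by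
    refine (Finset.card_le_card (support_monomial_subset)).trans (by simp)
  have h2 : (monomial b d).support.card ≤ 1 := by
    refine (Finset.card_le_card (support_monomial_subset)).trans (by simp)
  omega

lemma mem_Bin_of_isBinomial {f : MvPolynomial (Fin n) k} (h : IsBinomial f) : f ∈ Bin k n := by
  classical
  unfold IsBinomial at h
  have hs := f.support_sum_monomial_coeff
  interval_cases hc : f.support.card
  · rw [Finset.card_eq_zero] at hc
    rw [hc] at hs
    exact ⟨0, 0, 0, 0, by simpa using hs.symm⟩
  · obtain ⟨a, ha⟩ := Finset.card_eq_one.1 hc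
    rw [ha, Finset.sum_singleton] at hs
    exact ⟨a, 0, coeff a f, 0, by simpa using hs.symm⟩
  · obtain ⟨a, b, hab, ha⟩ := Finset.card_eq_two.1 hc
    rw [ha, Finset.sum_pair hab] at hs
    exact ⟨a, b, coeff a f, coeff b f, hs.symm⟩

/-- An ideal is `k`-linearly spanned by the binomials it contains. -/
lemma mem_span_of_binomial (hI : IsBinomialIdeal I) {f : MvPolynomial (Fin n) k} (hf : f ∈ I) :
    f ∈ Submodule.span k {g | g ∈ I ∧ g ∈ Bin k n} := by
  obtain ⟨S, hS, rfl⟩ := hI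
  refine Submodule.span_induction (p := fun f _ => f ∈ Submodule.span k
    {g | g ∈ Ideal.span S ∧ g ∈ Bin k n}) ?_ ?_ ?_ ?_ hf
  · intro x hx
    exact Submodule.subset_span ⟨Ideal.subset_span hx, mem_Bin_of_isBinomial (hS x hx)⟩
  · exact Submodule.zero_mem _
  · intro x y _ _ hx hy
    exact Submodule.add_mem _ hx hy
  · intro r x _ hx
    rw [smul_eq_mul]
    refine Submodule.span_induction (p := fun x _ => r * x ∈ Submodule.span k
      {g | g ∈ Ideal.span S ∧ g ∈ Bin k n}) ?_ ?_ ?_ ?_ hx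
    · rintro x ⟨hx, a, b, c, d, rfl⟩
      induction r using MvPolynomial.induction_on' with
      | monomial u e =>
        refine Submodule.subset_span ⟨Ideal.mul_mem_left _ _ hx, u + a, u + b, e * c, e * d, ?_⟩
        rw [mul_add, monomial_mul, monomial_mul]
      | add p q hp hq => rw [add_mul]; exact Submodule.add_mem _ hp hq
    · simp
    · intro x y _ _ hx hy
      rw [mul_add]; exact Submodule.add_mem _ hx hy
    · intro c x _ hx
      rw [mul_smul_comm]; exact Submodule.smul_mem _ _ hx

open Classical in
/-- Projection to the terms whose exponents satisfy a predicate. -/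
noncomputable def proj (k : Type*) [Field k] {n : ℕ} (P : (Fin n →₀ ℕ) → Prop) :
    MvPolynomial (Fin n) k →ₗ[k] MvPolynomial (Fin n) k :=
  (basisMonomials (Fin n) k).constr k (fun a => if P a then M k a else 0)

open Classical in
lemma proj_monomial (P : (Fin n →₀ ℕ) → Prop) (a : Fin n →₀ ℕ) (c : k) :
    proj k P (monomial a c) = if P a then monomial a c else 0 := by
  have h : monomial a c = c • basisMonomials (Fin n) k a := by
    simp [smul_monomial]
  rw [h, map_smul, proj, Module.Basis.constr_basis]
  split_ifs <;> simp [M]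

lemma proj_mem (hI : IsBinomialIdeal I) (a0 : Fin n →₀ ℕ) {f : MvPolynomial (Fin n) k}
    (hf : f ∈ I) : proj k (Cg I a0) f ∈ I := by
  classical
  refine Submodule.span_induction (p := fun f _ => proj k (Cg I a0) f ∈ I) ?_ ?_ ?_ ?_
    (mem_span_of_binomial hI hf)
  · rintro x ⟨hx, a, b, c, d, rfl⟩
    rw [map_add, proj_monomial, proj_monomial]
    by_cases hc : c = 0
    · subst hc
      split_ifs <;> simp_all
    by_cases hd : d = 0
    · subst hd
      split_ifs <;> simp_all
    have hab : Cg I a b := by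
      refine ⟨-(c⁻¹ * d), by simp [hc, hd], mem1 hx (C c⁻¹) ?_⟩
      rw [mon_eq a c, mon_eq b d, C_neg, C_mul]
      linear_combination (-M k a) * CC (n := n) hc
    by_cases h : Cg I a0 a
    · rwa [if_pos h, if_pos (h.trans hab)]
    · rw [if_neg h, if_neg (fun h' => h (h'.trans hab.symm))]; simp
  · simp
  · intro x y _ _ hx hy
    rw [map_add]; exact add_mem hx hy
  · intro c x _ hx
    rw [map_smul, smul_eq_C_mul]; exact I.mul_mem_left _ hx

/-- If all the terms congruent to `a` are the term `a`, then the term lies in the ideal. -/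
lemma reduce_or (hI : IsBinomialIdeal I) {f : MvPolynomial (Fin n) k} (m : Fin n →₀ ℕ)
    (hf : M k m * f ∈ I) {a : Fin n →₀ ℕ} (ha : a ∈ f.support) :
    M k (m + a) ∈ I ∨ ∃ b ∈ f.support, b ≠ a ∧ Cg I (m + a) (m + b) := by
  classical
  by_contra! hcon
  obtain ⟨h1, h2⟩ := hcon
  have h := proj_mem hI (m + a) hf
  rw [← f.support_sum_monomial_coeff, Finset.mul_sum, map_sum,
    Finset.sum_eq_single_of_mem a ha] at h
  · rw [monomial_mul, proj_monomial, if_pos (Cg.refl _), mon_eq, one_mul,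
      C_mul_mem_iff (mem_support_iff.1 ha)] at h
    exact h1 h
  · intro b hb hba
    rw [monomial_mul, proj_monomial, if_neg (h2 b hb hba)]

lemma card_support_lt {f : MvPolynomial (Fin n) k} {a : Fin n →₀ ℕ} (ha : a ∈ f.support) :
    (f - monomial a (coeff a f)).support.card < f.support.card := by
  classical
  refine Finset.card_lt_card ⟨fun b hb => ?_, fun h => ?_⟩
  · rw [mem_support_iff, coeff_sub, coeff_monomial] at hb
    rw [mem_support_iff]
    split_ifs at hb with h
    · subst h; simp at hb
    · simpa using hb
  · have := h ha
    simp [mem_support_iff, coeff_sub, coeff_monomial] at this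

lemma card_support_lt' {f : MvPolynomial (Fin n) k} {a b : Fin n →₀ ℕ} (ha : a ∈ f.support)
    (hb : b ∈ f.support) (hab : b ≠ a) (c : k) :
    (f - C (coeff a f) * (M k a - C c * M k b)).support ⊆ f.support ∧ 
    (f - C (coeff a f) * (M k a - C c * M k b)).support.card < f.support.card := by
  classical
  have key : ∀ d, coeff d (f - C (coeff a f) * (M k a - C c * M k b)) =
      coeff d f - coeff a f * ((if a = d then 1 else 0) - c * (if b = d then 1 else 0)) := by
    intro d
    rw [coeff_sub, coeff_C_mul, coeff_sub, coeff_C_mul, coeff_monomial, coeff_monomial]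
  have hsub : (f - C (coeff a f) * (M k a - C c * M k b)).support ⊆ f.support := by
    intro d hd
    rw [mem_support_iff, key] at hd
    rw [mem_support_iff] at ha hb ⊢
    by_cases h1 : a = d
    · subst h1; exact ha
    by_cases h2 : b = d
    · subst h2; exact hb
    simpa [h1, h2] using hd
  refine ⟨hsub, Finset.card_lt_card ⟨hsub, fun h => ?_⟩⟩
  have := h ha
  rw [mem_support_iff, key] at this
  simp [hab] at this

lemma isBinomial_M (a : Fin n →₀ ℕ) : IsBinomial (M k a) :=
  isBinomial_of_mem_Bin ⟨a, 0, 1, 0, by simp⟩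

lemma isBinomial_sub (a b : Fin n →₀ ℕ) (c : k) : IsBinomial (M k a - C c * M k b) :=
  isBinomial_of_mem_Bin ⟨a, b, 1, -c, by rw [mon_eq b, C_neg]; ring⟩

lemma binomial_sup_span (hI : IsBinomialIdeal I) (S : Set (MvPolynomial (Fin n) k))
    (hS : ∀ f ∈ S, IsBinomial f) : IsBinomialIdeal (I ⊔ Ideal.span S) := by
  obtain ⟨T, hT, rfl⟩ := hI
  refine ⟨T ∪ S, ?_, (Ideal.span_union T S).symm⟩
  rintro f (hf | hf)
  exacts [hT f hf, hS f hf]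

/-- `I : r`. -/
def qt {R : Type*} [CommRing R] (I : Ideal R) (r : R) : Ideal R where
  carrier := {f | r * f ∈ I}
  add_mem' {a b} ha hb := by
    simp only [Set.mem_ofPred_eq] at *
    rw [mul_add]; exact add_mem ha hb
  zero_mem' := by simp
  smul_mem' c x hx := mem1 hx c (by simp; ring)

lemma mem_qt {R : Type*} [CommRing R] {I : Ideal R} {r f : R} : f ∈ qt I r ↔ r * f ∈ I := Iff.rfl

lemma le_qt {R : Type*} [CommRing R] (I : Ideal R) (r : R) : I ≤ qt I r :=
  fun _ h => I.mul_mem_left _ h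

lemma binomial_qt (hI : IsBinomialIdeal I) (m : Fin n →₀ ℕ) : IsBinomialIdeal (qt I (M k m)) := by
  refine ⟨{g | g ∈ qt I (M k m) ∧ IsBinomial g}, fun f hf => hf.2, le_antisymm ?_ ?_⟩
  swap
  · exact Ideal.span_le.2 fun f hf => hf.1
  intro f hf
  induction hN : f.support.card using Nat.strong_induction_on generalizing f with
  | _ N ih =>
  subst hN
  by_cases h0 : f.support = ∅
  · rw [MvPolynomial.support_eq_empty] at h0
    subst h0; exact zero_mem _
  obtain ⟨a, ha⟩ := Finset.nonempty_iff_ne_empty.2 h0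
  rcases reduce_or hI m (mem_qt.1 hf) ha with h | ⟨b, hb, hba, c, hc, h⟩
  · have h1 : M k a ∈ qt I (M k m) := by rwa [mem_qt, ← M_add]
    have h2 : monomial a (coeff a f) ∈ qt I (M k m) := by
      rw [mon_eq]; exact Ideal.mul_mem_left _ _ h1
    have h3 := ih _ (card_support_lt ha) (f := f - monomial a (coeff a f)) (sub_mem hf h2) rfl
    have h4 : monomial a (coeff a f) ∈ Ideal.span {g | g ∈ qt I (M k m) ∧ IsBinomial g} := by
      rw [mon_eq]
      exact Ideal.mul_mem_left _ _ (Ideal.subset_span ⟨h1, isBinomial_M a⟩)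
    simpa using add_mem h3 h4
  · have h1 : M k a - C c * M k b ∈ qt I (M k m) := by
      rw [mem_qt]
      exact mem1 h 1 (by rw [M_add, M_add]; ring)
    have h3 := ih _ (card_support_lt' ha hb hba c).2
      (f := f - C (coeff a f) * (M k a - C c * M k b))
      (sub_mem hf (Ideal.mul_mem_left _ _ h1)) rfl
    have h4 : C (coeff a f) * (M k a - C c * M k b) ∈
        Ideal.span {g | g ∈ qt I (M k m) ∧ IsBinomial g} :=
      Ideal.mul_mem_left _ _ (Ideal.subset_span ⟨h1, isBinomial_sub a b c⟩)
    simpa using add_mem h3 h4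

end basics

section split
variable {k : Type*} [Field k] {n : ℕ}

/-- `I` is a finite intersection of strictly larger binomial ideals. -/
def Good (I : Ideal (MvPolynomial (Fin n) k)) : Prop :=
  ∃ s : Finset (Ideal (MvPolynomial (Fin n) k)), (∀ J ∈ s, IsBinomialIdeal J ∧ I < J) ∧ I = s.inf id

lemma split_qt {R : Type*} [CommRing R] {I : Ideal R} {a : R}
    (h : ∀ g, a * (a * g) ∈ I → a * g ∈ I) : I = qt I a ⊓ (I ⊔ Ideal.span {a}) := by
  refine le_antisymm (le_inf (le_qt I a) le_sup_left) ?_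
  rintro f ⟨h1, h2⟩
  obtain ⟨i, hi, j, hj, rfl⟩ := Submodule.mem_sup.1 h2
  obtain ⟨g, rfl⟩ := Ideal.mem_span_singleton'.1 hj
  have h1 : a * (i + g * a) ∈ I := h1
  have h3 : a * (a * g) ∈ I := mem2 h1 hi 1 (-a) (by ring)
  exact add_mem hi (mem1 (h g h3) 1 (by ring))

variable {I : Ideal (MvPolynomial (Fin n) k)}

lemma good_of_qt (hI : IsBinomialIdeal I) {a : MvPolynomial (Fin n) k} (ha : IsBinomial a)
    (hq : IsBinomialIdeal (qt I a)) (h : ∀ g, a * (a * g) ∈ I → a * g ∈ I)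
    (hna : a ∉ I) (hz : ¬ Nz I a) : Good I := by
  classical
  refine ⟨{qt I a, I ⊔ Ideal.span {a}}, ?_, by simpa using split_qt h⟩
  intro J hJ
  rw [Finset.mem_insert, Finset.mem_singleton] at hJ
  rcases hJ with rfl | rfl
  · refine ⟨hq, lt_of_le_of_ne (le_qt I a) fun h => hz fun g hg => ?_⟩
    rw [h]; exact hg
  · refine ⟨binomial_sup_span hI _ (by simpa using ha), lt_of_le_of_ne le_sup_left fun h => hna ?_⟩
    rw [h]
    exact Ideal.mem_sup_right (Ideal.mem_span_singleton_self a)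

lemma exists_stable {R : Type*} [CommRing R] [IsNoetherianRing R] (I : Ideal R) (r : R) :
    ∃ N : ℕ, ∀ m : ℕ, ∀ g, r ^ m * g ∈ I → r ^ (N + 1) * g ∈ I := by
  have hmono : Monotone (fun N : ℕ => qt I (r ^ N)) := by
    intro N N' h f hf
    obtain ⟨d, rfl⟩ := Nat.exists_eq_add_of_le h
    exact mem_qt.2 (mem1 (mem_qt.1 hf) (r ^ d) (by rw [pow_add]; ring))
  obtain ⟨N, hN⟩ := monotone_stabilizes_iff_noetherian.2
    (inferInstance : IsNoetherian R R) ⟨_, hmono⟩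
  have hN' : ∀ m, N ≤ m → qt I (r ^ N) = qt I (r ^ m) := hN
  refine ⟨N, fun m g hg => ?_⟩
  have h1 : g ∈ qt I (r ^ (N + 1 + m)) := by
    rw [mem_qt, pow_add, mul_assoc]; exact I.mul_mem_left _ hg
  rw [← hN' _ (by omega), hN' (N + 1) (by omega)] at h1
  exact h1

lemma good_of_monomial (hI : IsBinomialIdeal I) (u : Fin n →₀ ℕ) (hz : ¬ Nz I (M k u))
    (hn : ∀ N : ℕ, M k u ^ N ∉ I) : Good I := by
  obtain ⟨N, hN⟩ := exists_stable I (M k u)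
  refine good_of_qt hI (a := M k u ^ (N + 1)) ?_ ?_ ?_ (hn _) ?_
  · rw [← M_nsmul]; exact isBinomial_M _
  · rw [← M_nsmul]; exact binomial_qt hI _
  · intro g hg
    refine hN (N + 1 + (N + 1)) g ?_
    rw [pow_add, mul_assoc]; exact hg
  · intro h
    rw [pow_succ'] at h
    exact hz h.of_mul_left

lemma lemmaK (hI : IsBinomialIdeal I) {u v : Fin n →₀ ℕ} (hu : Nz I (M k u)) (hv : Nz I (M k v))
    {c : k} {f : MvPolynomial (Fin n) k}
    (hbf : (M k u - C c * M k v) * f ∈ I) :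
    f ∈ I ⊔ Ideal.span {g | ∃ (a : Fin n →₀ ℕ) (j : ℕ), 0 < j ∧ g = M k a ∧
      (M k u ^ j - C c ^ j * M k v ^ j) * M k a ∈ I} := by
  classical
  set K := I ⊔ Ideal.span {g | ∃ (a : Fin n →₀ ℕ) (j : ℕ), 0 < j ∧ g = M k a ∧
      (M k u ^ j - C c ^ j * M k v ^ j) * M k a ∈ I} with hK
  have hIK : I ≤ K := le_sup_left
  induction hN : f.support.card using Nat.strong_induction_on generalizing f with
  | _ N ih =>
  subst hN
  by_cases hA : ∃ a ∈ f.support, M k a ∈ I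
  · obtain ⟨a, ha, haI⟩ := hA
    have h2 : monomial a (coeff a f) ∈ I := by
      rw [mon_eq]; exact Ideal.mul_mem_left _ _ haI
    have h := ih _ (card_support_lt ha) (f := f - monomial a (coeff a f))
      (by rw [mul_sub]; exact sub_mem hbf (I.mul_mem_left _ h2)) rfl
    simpa using add_mem h (hIK h2)
  by_cases hB : ∃ a ∈ f.support, ∃ b ∈ f.support, b ≠ a ∧ Cg I a b
  · obtain ⟨a, ha, b, hb, hba, d, hd, h⟩ := hB
    have h2 : C (coeff a f) * (M k a - C d * M k b) ∈ I := Ideal.mul_mem_left _ _ h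
    have h := ih _ (card_support_lt' ha hb hba d).2
      (f := f - C (coeff a f) * (M k a - C d * M k b))
      (by rw [mul_sub]; exact sub_mem hbf (I.mul_mem_left _ h2)) rfl
    simpa using add_mem h (hIK h2)
  push Not at hA hB
  have hstep : ∀ a : f.support, ∃ a' : f.support, C (coeff a f) * M k u * M k a -
      C c * C (coeff a' f) * M k v * M k a' ∈ I := by
    rintro ⟨a, ha⟩
    have hexp : (M k u - C c * M k v) * f = ∑ b ∈ f.support, monomial (u + b) (coeff b f) -
        ∑ b ∈ f.support, monomial (v + b) (c * coeff b f) := by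
      conv_lhs => rw [← f.support_sum_monomial_coeff]
      rw [sub_mul, Finset.mul_sum, Finset.mul_sum]
      congr 1
      · exact Finset.sum_congr rfl fun b _ => by rw [monomial_mul, one_mul]
      · exact Finset.sum_congr rfl fun b _ => by
          rw [← mon_eq, monomial_mul]
    have h := proj_mem hI (u + a) hbf
    rw [hexp, map_sub, map_sum, map_sum, Finset.sum_eq_single_of_mem a ha] at h
    swap
    · intro b hb hba
      rw [proj_monomial, if_neg fun h => hB a ha b hb hba (h.cancel hu)]
    rw [proj_monomial, if_pos (Cg.refl _)] at h
    by_cases hex : ∃ a' ∈ f.support, Cg I (u + a) (v + a')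
    · obtain ⟨a', ha', hca'⟩ := hex
      refine ⟨⟨a', ha'⟩, ?_⟩
      rw [Finset.sum_eq_single_of_mem a' ha', proj_monomial, if_pos hca'] at h
      · refine mem1 h 1 ?_
        rw [mon_eq, mon_eq, M_add, M_add, C_mul]; ring
      · intro b hb hba
        rw [proj_monomial, if_neg fun h => hB a' ha' b hb hba ((hca'.symm.trans h).cancel hv)]
    · push Not at hex
      rw [Finset.sum_eq_zero, sub_zero, mon_eq, C_mul_mem_iff (mem_support_iff.1 ha), M_add] at h
      · exact absurd (hu _ h) (hA a ha)
      · intro b hb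
        rw [proj_monomial, if_neg (hex b hb)]
  choose π hπ using hstep
  have hiter : ∀ (j : ℕ) (a : f.support), C (coeff a f) * M k u ^ j * M k a -
      C c ^ j * C (coeff (π^[j] a) f) * M k v ^ j * M k (π^[j] a) ∈ I := by
    intro j
    induction j with
    | zero => intro a; simp
    | succ j ihj =>
      intro a
      rw [Function.iterate_succ_apply]
      refine mem2 (hπ a) (ihj (π a)) (M k u ^ j) (C c * M k v) ?_
      ring
  have hinj : Function.Injective π := by
    intro a b hab
    by_contra hne
    have h1 := hπ a
    have h2 := hπ b
    rw [hab] at h1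
    refine hB a a.2 b b.2 (fun h => hne (Subtype.ext h.symm)) ?_
    refine ⟨(coeff (a : Fin n →₀ ℕ) f)⁻¹ * coeff (b : Fin n →₀ ℕ) f,
      mul_ne_zero (inv_ne_zero (mem_support_iff.1 a.2)) (mem_support_iff.1 b.2), hu _ ?_⟩
    refine mem2 h1 h2 (C (coeff (a : Fin n →₀ ℕ) f)⁻¹) (-C (coeff (a : Fin n →₀ ℕ) f)⁻¹) ?_
    rw [C_mul]
    linear_combination (-M k u * M k (a : Fin n →₀ ℕ)) * CC (n := n) (mem_support_iff.1 a.2)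
  have hall : ∀ a ∈ f.support, M k a ∈ K := by
    intro a ha
    obtain ⟨i, j, hij, he⟩ : ∃ i j : ℕ, i < j ∧ π^[i] ⟨a, ha⟩ = π^[j] ⟨a, ha⟩ := by
      obtain ⟨i, j, hij, he⟩ := Finite.exists_ne_map_eq_of_infinite (fun i : ℕ => π^[i] ⟨a, ha⟩)
      rcases lt_or_gt_of_ne hij with h | h
      · exact ⟨i, j, h, he⟩
      · exact ⟨j, i, h, he.symm⟩
    have hp : π^[j - i] ⟨a, ha⟩ = ⟨a, ha⟩ := by
      apply hinj.iterate i
      rw [← Function.iterate_add_apply, Nat.add_sub_cancel' hij.le, he]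
    have h := hiter (j - i) ⟨a, ha⟩
    rw [hp] at h
    refine Ideal.mem_sup_right (Ideal.subset_span ⟨a, j - i, by omega, rfl, ?_⟩)
    rw [← C_mul_mem_iff (mem_support_iff.1 ha)]
    refine mem1 h 1 ?_
    ring
  rw [← f.support_sum_monomial_coeff]
  refine sum_mem fun a ha => ?_
  rw [mon_eq]
  exact K.mul_mem_left _ (hall a ha)

lemma reduce_three {a w z : Fin n →₀ ℕ} (hI : IsBinomialIdeal I)
    (hw : Nz I (M k w)) (hz : Nz I (M k z)) {c : k}
    (h : (M k w - C c * M k z) ^ 2 * M k a ∈ I) :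
    ∃ i : ℕ, 0 < i ∧ (M k w ^ i - C c ^ i * M k z ^ i) * M k a ∈ I := by
  classical
  by_cases haI : M k a ∈ I
  · exact ⟨1, one_pos, I.mul_mem_left _ haI⟩
  have hexp : (M k w - C c * M k z) ^ 2 * M k a = monomial (w + w + a) 1 +
      monomial (w + z + a) (-2 * c) + monomial (z + z + a) (c * c) := by
    rw [mon_eq, mon_eq _ (-2 * c), mon_eq _ (c * c)]
    simp only [M_add, C_mul, C_neg, C_1]
    rw [show (C (2 : k) : MvPolynomial (Fin n) k) = 2 from rfl]
    ring
  have key : ∃ i : ℕ, 0 < i ∧ ∃ l : k, (M k w ^ i - C l * M k z ^ i) * M k a ∈ I := by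
    by_contra! hcon
    have h1 : ¬ Cg I (w + w + a) (w + z + a) := by
      rintro ⟨l, -, hl⟩
      refine hcon 1 one_pos l (hw _ (mem1 hl 1 ?_))
      simp only [M_add]; ring
    have h2 : ¬ Cg I (w + w + a) (z + z + a) := by
      rintro ⟨l, -, hl⟩
      refine hcon 2 two_pos l (mem1 hl 1 ?_)
      simp only [M_add]; ring
    have h3 := proj_mem hI (w + w + a) h
    rw [hexp, map_add, map_add, proj_monomial, proj_monomial, proj_monomial, if_pos (Cg.refl _),
      if_neg h1, if_neg h2, add_zero, add_zero] at h3
    change M k _ ∈ I at h3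
    rw [M_add, M_add] at h3
    exact haI ((hw.mul hw) _ h3)
  obtain ⟨i, hi, l, hl⟩ := key
  refine ⟨i, hi, ?_⟩
  by_cases hlc : l = c ^ i
  · subst hlc; simpa using hl
  exfalso
  obtain ⟨q, hq⟩ := sub_dvd_pow_sub_pow (M k w) (C c * M k z) i
  have h2 : (M k w ^ i - C c ^ i * M k z ^ i) ^ 2 * M k a ∈ I := by
    rw [← mul_pow, hq]
    exact mem1 h (q ^ 2) (by ring)
  have h3 : C (l - c ^ i) * (C (l - c ^ i) * (M k z ^ i * (M k z ^ i * M k a))) ∈ I := by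
    rw [C_sub, C_pow]
    refine mem2 h2 hl 1 (-(M k w ^ i - C c ^ i * M k z ^ i) - (C l - C c ^ i) * M k z ^ i) ?_
    ring
  rw [C_mul_mem_iff (sub_ne_zero.2 hlc), C_mul_mem_iff (sub_ne_zero.2 hlc)] at h3
  exact haI (hz.pow i _ (hz.pow i _ h3))

end split

section crt

lemma cop {R ι : Type*} [CommRing R] (s : Finset ι) (b : ι → R) (y : R) (a : R)
    (h : ∀ i ∈ s, ∃ p q, y = p * a + q * b i) :
    ∃ (m : ℕ) (p q : R), y ^ m = p * a + q * ∏ i ∈ s, b i := by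
  classical
  induction s using Finset.induction_on with
  | empty => exact ⟨0, 0, 1, by simp⟩
  | insert c s hc ih =>
    obtain ⟨m, p, q, hm⟩ := ih fun i hi => h i (Finset.mem_insert_of_mem hi)
    obtain ⟨p', q', h'⟩ := h c (Finset.mem_insert_self _ _)
    refine ⟨m + 1, p * y + p' * q * ∏ i ∈ s, b i, q * q', ?_⟩
    rw [Finset.prod_insert hc, pow_succ, hm]
    linear_combination (q * ∏ i ∈ s, b i) * h'

lemma crt {R ι : Type*} [CommRing R] (I : Ideal R) (s : Finset ι) (b : ι → R) (y : R)
    (h : ∀ i ∈ s, ∀ j ∈ s, i ≠ j → ∃ p q, y = p * b i + q * b j) (f : R)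
    (hf : ∀ i ∈ s, ∃ N : ℕ, y ^ N * f ∈ I ⊔ Ideal.span {b i}) :
    ∃ N : ℕ, y ^ N * f ∈ I ⊔ Ideal.span {∏ i ∈ s, b i} := by
  classical
  induction s using Finset.induction_on with
  | empty => exact ⟨0, by simp⟩
  | insert c s hc ih =>
    obtain ⟨N, hN⟩ := ih (fun i hi j hj => h i (Finset.mem_insert_of_mem hi) j
      (Finset.mem_insert_of_mem hj)) (fun i hi => hf i (Finset.mem_insert_of_mem hi))
    obtain ⟨N', hN'⟩ := hf c (Finset.mem_insert_self _ _)
    obtain ⟨m, p, q, hm⟩ := cop s b y (b c) (fun i hi => h c (Finset.mem_insert_self _ _) i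
      (Finset.mem_insert_of_mem hi) (fun hh => hc (hh ▸ hi)))
    rw [Finset.prod_insert hc]
    obtain ⟨i1, hi1, j1, hj1, e1⟩ := Submodule.mem_sup.1 hN
    obtain ⟨g1, rfl⟩ := Ideal.mem_span_singleton'.1 hj1
    obtain ⟨i2, hi2, j2, hj2, e2⟩ := Submodule.mem_sup.1 hN'
    obtain ⟨g2, rfl⟩ := Ideal.mem_span_singleton'.1 hj2
    refine ⟨N + N' + m, ?_⟩
    have : y ^ (N + N' + m) * f = (p * b c * y ^ N' * i1 + q * (∏ i ∈ s, b i) * y ^ N * i2) +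
        (p * y ^ N' * g1 + q * y ^ N * g2) * (b c * ∏ i ∈ s, b i) := by
      rw [pow_add, pow_add, hm]
      linear_combination (-p * b c * y ^ N') * e1 - (q * (∏ i ∈ s, b i) * y ^ N) * e2
    rw [this]
    exact add_mem (Ideal.mem_sup_left (add_mem (I.mul_mem_left _ hi1) (I.mul_mem_left _ hi2)))
      (Ideal.mem_sup_right (Ideal.mul_mem_left _ _ (Ideal.mem_span_singleton_self _)))

end crt

section split2
variable {k : Type*} [Field k] [IsAlgClosed k] [CharZero k] {n : ℕ}

lemma exists_factor (e : ℕ) (he : 0 < e) : ∃ s : Finset k, (∀ r ∈ s, r ≠ 0) ∧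
    ∀ X Y : MvPolynomial (Fin n) k, X ^ e - Y ^ e = ∏ r ∈ s, (X - C r * Y) := by
  classical
  have : NeZero e := ⟨he.ne'⟩
  have : NeZero (e : k) := ⟨by exact_mod_cast he.ne'⟩
  obtain ⟨ζ, hζ⟩ := HasEnoughRootsOfUnity.exists_primitiveRoot k e
  have hζ' : IsPrimitiveRoot (C ζ : MvPolynomial (Fin n) k) e :=
    hζ.map_of_injective (f := (C : k →+* MvPolynomial (Fin n) k)) (C_injective _ _)
  refine ⟨Polynomial.nthRootsFinset e (1 : k), ?_, ?_⟩
  · rintro r hr rfl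
    rw [Polynomial.mem_nthRootsFinset he] at hr
    simp [he.ne'] at hr
  · intro X Y
    rw [hζ'.pow_sub_pow_eq_prod_sub_mul X Y he]
    symm
    refine Finset.prod_bij (fun r _ => C r) ?_ ?_ ?_ ?_
    · intro r hr
      rw [Polynomial.mem_nthRootsFinset he] at hr ⊢
      rw [← C_pow, hr, C_1]
    · intro a _ b _ h
      exact C_injective _ _ h
    · intro r hr
      rw [Polynomial.mem_nthRootsFinset he] at hr
      obtain ⟨i, hi, rfl⟩ := hζ'.eq_pow_of_pow_eq_one hr
      refine ⟨ζ ^ i, ?_, C_pow _ _⟩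
      rw [Polynomial.mem_nthRootsFinset he, ← pow_mul, mul_comm, pow_mul, hζ.pow_eq_one, one_pow]
    · intro r hr
      rfl

variable {I : Ideal (MvPolynomial (Fin n) k)}

lemma good_of_roots (hI : IsBinomialIdeal I) {u v : Fin n →₀ ℕ}
    (hv : Nz I (M k v)) {c : k} (hc : c ≠ 0) (hb : M k u - C c * M k v ∉ I)
    (hz : ¬ Nz I (M k u - C c * M k v)) {e : ℕ} (he : 0 < e)
    (hbe : M k u ^ e - (C c * M k v) ^ e ∈ I) : Good I := by
  classical
  obtain ⟨s, hs, hfac⟩ := exists_factor (k := k) (n := n) e he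
  rw [hfac] at hbe
  set b : k → MvPolynomial (Fin n) k := fun r => M k u - C r * (C c * M k v) with hbdef
  choose N hN using fun r : k => exists_stable (I ⊔ Ideal.span {b r}) (M k v)
  have hmem : ∀ r, b r ∈ qt (I ⊔ Ideal.span {b r}) (M k v ^ (N r + 1)) := fun r =>
    le_qt _ _ (Ideal.mem_sup_right (Ideal.mem_span_singleton_self _))
  have hle : ∀ r, I ≤ qt (I ⊔ Ideal.span {b r}) (M k v ^ (N r + 1)) := fun r =>
    le_sup_left.trans (le_qt _ _)
  refine ⟨s.image fun r => qt (I ⊔ Ideal.span {b r}) (M k v ^ (N r + 1)), ?_, ?_⟩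
  · intro J hJ
    obtain ⟨r, hr, rfl⟩ := Finset.mem_image.1 hJ
    refine ⟨?_, lt_of_le_of_ne (hle r) fun h => ?_⟩
    · rw [← M_nsmul]
      refine binomial_qt (binomial_sup_span hI _ ?_) _
      rintro f rfl
      rw [hbdef]
      simp only
      rw [← mul_assoc, ← C_mul]
      exact isBinomial_sub _ _ _
    · have hbr := hmem r
      rw [← h] at hbr
      refine hz fun g hg => ?_
      have h1 : C (r * c - c) * (M k v * g) ∈ I := by
        refine mem2 hg hbr 1 (-g) ?_
        rw [hbdef, C_sub, C_mul]; ring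
      by_cases h0 : r * c - c = 0
      · exfalso
        refine hb (mem1 hbr 1 ?_)
        have h0' : C (r * c - c) = (0 : MvPolynomial (Fin n) k) := by rw [h0, C_0]
        rw [C_sub, C_mul] at h0'
        rw [hbdef]
        linear_combination M k v * h0'
      · rw [C_mul_mem_iff h0] at h1
        exact hv _ h1
  · refine le_antisymm ?_ ?_
    · rw [Finset.inf_image]
      exact Finset.le_inf fun r _ => hle r
    · intro f hf
      have hf' : ∀ r ∈ s, ∃ N : ℕ, M k v ^ N * f ∈ I ⊔ Ideal.span {b r} := by
        intro r hr
        refine ⟨N r + 1, ?_⟩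
        rw [Finset.inf_image] at hf
        exact (show s.inf (id ∘ fun r => qt (I ⊔ Ideal.span {b r}) (M k v ^ (N r + 1))) ≤
          qt (I ⊔ Ideal.span {b r}) (M k v ^ (N r + 1)) from Finset.inf_le hr) hf
      have hpair : ∀ i ∈ s, ∀ j ∈ s, i ≠ j → ∃ p q, M k v = p * b i + q * b j := by
        intro i _ j _ hij
        have hd : (j - i) * c ≠ 0 := mul_ne_zero (sub_ne_zero.2 hij.symm) hc
        refine ⟨C ((j - i) * c)⁻¹, -C ((j - i) * c)⁻¹, ?_⟩
        have := CC (n := n) hd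
        rw [hbdef]
        simp only
        rw [C_mul, C_sub] at this
        linear_combination (-M k v) * this
      obtain ⟨m, hm⟩ := crt I s b (M k v) hpair f hf'
      refine hv.pow m _ ?_
      have hle' : Ideal.span {∏ r ∈ s, b r} ≤ I := by
        rw [Ideal.span_singleton_le_iff_mem]
        exact hbe
      rwa [sup_eq_left.2 hle'] at hm

lemma good_of_binomial (hI : IsBinomialIdeal I) {u v : Fin n →₀ ℕ} (hu : Nz I (M k u))
    (hv : Nz I (M k v)) {c : k} (hc : c ≠ 0) (hb : M k u - C c * M k v ∉ I)
    (hz : ¬ Nz I (M k u - C c * M k v)) : Good I := by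
  classical
  set be : ℕ → MvPolynomial (Fin n) k := fun e => M k u ^ e - (C c * M k v) ^ e with hbe
  have hdvd : ∀ e j, be e ∣ be (e * j) := by
    intro e j
    simp only [hbe]
    rw [pow_mul, pow_mul]
    exact sub_dvd_pow_sub_pow _ _ _
  set J : ℕ → Ideal (MvPolynomial (Fin n) k) := fun e =>
    I ⊔ Ideal.span {g | ∃ a, g = M k a ∧ be e * M k a ∈ I} with hJ
  have hJq : ∀ e, J e ≤ qt I (be e) := by
    intro e
    refine sup_le (le_qt _ _) (Ideal.span_le.2 ?_)
    rintro g ⟨a, rfl, ha⟩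
    exact ha
  have hJmono : ∀ e j, J e ≤ J (e * j) := by
    intro e j
    refine sup_le_sup_left (Ideal.span_mono ?_) _
    rintro g ⟨a, rfl, ha⟩
    refine ⟨a, rfl, ?_⟩
    obtain ⟨q, hq⟩ := hdvd e j
    rw [hq]
    exact mem1 ha q (by ring)
  obtain ⟨e, he, hmax⟩ : ∃ e, 0 < e ∧ ∀ j, 0 < j → J (e * j) ≤ J e := by
    obtain ⟨K, ⟨e, rfl⟩, hK⟩ := set_has_maximal_iff_noetherian.2
      (inferInstance : IsNoetherian (MvPolynomial (Fin n) k) (MvPolynomial (Fin n) k))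
      (Set.range fun e => J (e + 1)) ⟨J 1, 0, rfl⟩
    refine ⟨e + 1, Nat.succ_pos e, fun j hj => ?_⟩
    have hpos : 0 < (e + 1) * j := Nat.mul_pos (Nat.succ_pos e) hj
    have := hK (J ((e + 1) * j)) ⟨(e + 1) * j - 1, by
      simp only
      rw [Nat.sub_add_cancel hpos]⟩
    by_contra h
    exact this (lt_of_le_of_ne (hJmono (e + 1) j) fun h' => h h'.ge)
  have hstar : ∀ j, 0 < j → ∀ a, be (e * j) * M k a ∈ I → M k a ∈ J e := fun j hj a ha =>
    hmax j hj (Ideal.mem_sup_right (Ideal.subset_span ⟨a, rfl, ha⟩))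
  have hbeq : ∀ j, M k (e • u) ^ j - C (c ^ e) ^ j * M k (e • v) ^ j = be (e * j) := by
    intro j
    simp only [hbe, M_nsmul, C_pow, mul_pow, pow_mul]
  have hbe1 : M k (e • u) - C (c ^ e) * M k (e • v) = be e := by
    simpa using hbeq 1
  have hue : Nz I (M k (e • u)) := by rw [M_nsmul]; exact hu.pow e
  have hve : Nz I (M k (e • v)) := by rw [M_nsmul]; exact hv.pow e
  have hJeq : qt I (be e) = J e := by
    refine le_antisymm (fun f hf => ?_) (hJq e)
    rw [mem_qt, ← hbe1] at hf
    refine (sup_le (le_sup_left : I ≤ J e) (Ideal.span_le.2 ?_)) (lemmaK hI hue hve hf)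
    rintro g ⟨a, j, hj, rfl, ha⟩
    rw [hbeq] at ha
    exact hstar j hj a ha
  have hJbin : IsBinomialIdeal (J e) := by
    refine binomial_sup_span hI _ ?_
    rintro f ⟨a, rfl, -⟩
    exact isBinomial_M a
  have hJnz : ∀ f, Nz I f → Nz (J e) f := by
    intro f hf g hg
    rw [← hJeq, mem_qt] at hg ⊢
    exact hf _ (mem1 hg 1 (by ring))
  by_cases hbI : be e ∈ I
  · exact good_of_roots hI hv hc hb hz he hbI
  refine good_of_qt hI (a := be e) ?_ ?_ ?_ hbI ?_
  · rw [← hbe1]; exact isBinomial_sub _ _ _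
  · rw [hJeq]; exact hJbin
  · intro g hg
    have h1 : be e * g ∈ J e := by rw [← hJeq]; exact hg
    rw [← hbe1] at h1
    have h2 := lemmaK hJbin (hJnz _ hue) (hJnz _ hve) h1
    suffices h3 : g ∈ J e by rw [← hJeq] at h3; exact h3
    refine (sup_le (le_refl (J e)) (Ideal.span_le.2 ?_)) h2
    rintro g ⟨a, j, hj, rfl, ha⟩
    rw [hbeq, ← hJeq, mem_qt] at ha
    obtain ⟨q, hq⟩ := hdvd e j
    have h4 : (M k ((e * j) • u) - C (c ^ (e * j)) * M k ((e * j) • v)) ^ 2 * M k a ∈ I := by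
      have : M k ((e * j) • u) - C (c ^ (e * j)) * M k ((e * j) • v) = be (e * j) := by
        simp only [hbe, M_nsmul, C_pow, mul_pow]
      rw [this]
      refine mem1 ha q ?_
      rw [sq]
      nth_rewrite 1 [hq]
      ring
    obtain ⟨i, hi, h5⟩ := reduce_three hI (by rw [M_nsmul]; exact hu.pow _)
      (by rw [M_nsmul]; exact hv.pow _) h4
    refine hstar (j * i) (Nat.mul_pos hj hi) a ?_
    have : M k ((e * j) • u) ^ i - C (c ^ (e * j)) ^ i * M k ((e * j) • v) ^ i
        = be (e * (j * i)) := by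
      simp only [hbe, M_nsmul, C_pow, mul_pow, ← pow_mul, mul_assoc]
    rwa [this] at h5
  · intro h
    obtain ⟨q, hq⟩ := hdvd 1 e
    rw [one_mul] at hq
    rw [hq] at h
    have := h.of_mul_left
    simp only [hbe, pow_one] at this
    exact hz this

end split2

section primary
variable {k : Type*} [Field k] {n : ℕ}

/-- Integer vector attached to an exponent. -/
def toZ (u : Fin n →₀ ℕ) : Fin n → ℤ := fun i => (u i : ℤ)

lemma toZ_add (u v : Fin n →₀ ℕ) : toZ (u + v) = toZ u + toZ v := by
  funext i; simp [toZ]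

lemma toZ_nsmul (e : ℕ) (u : Fin n →₀ ℕ) : toZ (e • u) = e • toZ u := by
  funext i; simp [toZ]

lemma toZ_inj {u v : Fin n →₀ ℕ} (h : toZ u = toZ v) : u = v := by
  ext i
  have := congrFun h i
  simpa [toZ] using this

lemma nz_M_add {I : Ideal (MvPolynomial (Fin n) k)} {u v : Fin n →₀ ℕ} (hu : Nz I (M k u))
    (hv : Nz I (M k v)) : Nz I (M k (u + v)) := by
  rw [M_add]; exact hu.mul hv

lemma nz_M_zero (I : Ideal (MvPolynomial (Fin n) k)) : Nz I (M k (0 : Fin n →₀ ℕ)) := by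
  intro g hg
  rwa [M_zero, one_mul] at hg

lemma nz_M_le {I : Ideal (MvPolynomial (Fin n) k)} {u v : Fin n →₀ ℕ} (hv : Nz I (M k v))
    (h : u ≤ v) : Nz I (M k u) := by
  rw [← add_tsub_cancel_of_le h, M_add] at hv
  exact hv.of_mul_left

/-- The lattice of an ideal. -/
def lat (I : Ideal (MvPolynomial (Fin n) k)) : AddSubgroup (Fin n → ℤ) where
  carrier := {w | ∃ u v, Nz I (M k u) ∧ Nz I (M k v) ∧ Cg I u v ∧ w = toZ u - toZ v}
  zero_mem' := ⟨0, 0, nz_M_zero I, nz_M_zero I, Cg.refl _, by simp⟩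
  add_mem' := by
    rintro _ _ ⟨u, v, hu, hv, h, rfl⟩ ⟨u', v', hu', hv', h', rfl⟩
    refine ⟨u + u', v + v', nz_M_add hu hu', nz_M_add hv hv', h.add h', ?_⟩
    rw [toZ_add, toZ_add]; abel
  neg_mem' := by
    rintro _ ⟨u, v, hu, hv, h, rfl⟩
    exact ⟨v, u, hv, hu, h.symm, by abel⟩

variable {I : Ideal (MvPolynomial (Fin n) k)}

lemma mem_lat {w : Fin n → ℤ} : w ∈ lat I ↔
    ∃ u v, Nz I (M k u) ∧ Nz I (M k v) ∧ Cg I u v ∧ w = toZ u - toZ v := Iff.rfl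

lemma cg_of_mem_lat {u v : Fin n →₀ ℕ} (h : toZ u - toZ v ∈ lat I) : Cg I u v := by
  obtain ⟨p, q, hp, hq, hpq, h⟩ := mem_lat.1 h
  have h1 : q + u = p + v := by
    apply toZ_inj
    rw [toZ_add, toZ_add]
    linear_combination h
  refine Cg.cancel hq ?_
  rw [h1]
  exact hpq.add (Cg.refl v)

lemma lat_torsion [IsAlgClosed k] [CharZero k] (hne : I ≠ ⊤)
    (H2 : ∀ u v, Nz I (M k u) → Nz I (M k v) → ∀ c : k, c ≠ 0 →
      M k u - C c * M k v ∈ I ∨ Nz I (M k u - C c * M k v))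
    {w : Fin n → ℤ} {e : ℕ} (he : 0 < e) (hw : e • w ∈ lat I) : w ∈ lat I := by
  obtain ⟨a, b, ha, hb, -, hab⟩ := mem_lat.1 hw
  set p : Fin n →₀ ℕ := Finsupp.equivFunOnFinite.symm fun i => (w i).toNat with hp
  set q : Fin n →₀ ℕ := Finsupp.equivFunOnFinite.symm fun i => (-w i).toNat with hq
  have hpi : ∀ i, p i = (w i).toNat := fun i => rfl
  have hqi : ∀ i, q i = (-w i).toNat := fun i => rfl
  have hwpq : w = toZ p - toZ q := by
    funext i
    simp only [toZ, Pi.sub_apply, hpi, hqi]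
    omega
  have habi : ∀ i, (e : ℤ) * w i = a i - b i := by
    intro i
    have := congrFun hab i
    simpa [toZ] using this
  have hpa : e • p ≤ a := by
    intro i
    rw [Finsupp.smul_apply, smul_eq_mul, hpi]
    zify
    rcases le_total 0 (w i) with h | h
    · rw [Int.toNat_of_nonneg h]
      have := habi i
      have h2 : (0 : ℤ) ≤ b i := Int.natCast_nonneg _
      linarith
    · rw [Int.toNat_of_nonpos h]; simp
  have hqb : e • q ≤ b := by
    intro i
    rw [Finsupp.smul_apply, smul_eq_mul, hqi]
    zify
    rcases le_total 0 (-w i) with h | h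
    · rw [Int.toNat_of_nonneg h]
      have := habi i
      have h2 : (0 : ℤ) ≤ a i := Int.natCast_nonneg _
      linarith
    · rw [Int.toNat_of_nonpos h]; simp
  have hle : ∀ x : Fin n →₀ ℕ, x ≤ e • x := fun x i => by
    rw [Finsupp.smul_apply, smul_eq_mul]
    exact Nat.le_mul_of_pos_left _ he
  have hpU : Nz I (M k p) := nz_M_le ha ((hle p).trans hpa)
  have hqU : Nz I (M k q) := nz_M_le hb ((hle q).trans hqb)
  refine mem_lat.2 ⟨p, q, hpU, hqU, ?_, hwpq⟩
  have hcg : Cg I (e • p) (e • q) := by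
    apply cg_of_mem_lat
    rw [toZ_nsmul, toZ_nsmul, ← smul_sub, ← hwpq]
    exact hw
  obtain ⟨c, hc, hcI⟩ := hcg
  obtain ⟨d, rfl⟩ := IsAlgClosed.exists_pow_nat_eq c he
  have hd : d ≠ 0 := by
    rintro rfl
    exact hc (zero_pow he.ne')
  obtain ⟨s, hs, hfac⟩ := exists_factor (k := k) (n := n) e he
  rw [M_nsmul, M_nsmul, C_pow, ← mul_pow, hfac] at hcI
  by_contra hcon
  have hall : ∀ t ⊆ s, Nz I (∏ r ∈ t, (M k p - C r * (C d * M k q))) := by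
    classical
    intro t
    induction t using Finset.induction_on with
    | empty => intro _ g hg; simpa using hg
    | insert r t hr ih =>
      intro hts
      rw [Finset.prod_insert hr]
      refine Nz.mul ?_ (ih fun x hx => hts (Finset.mem_insert_of_mem hx))
      have hrd : r * d ≠ 0 := mul_ne_zero (hs r (hts (Finset.mem_insert_self _ _))) hd
      rw [← mul_assoc, ← C_mul]
      rcases H2 p q hpU hqU _ hrd with h | h
      · exact absurd ⟨_, hrd, h⟩ hcon
      · exact h
  refine hne ((Ideal.eq_top_iff_one _).2 (hall s subset_rfl 1 ?_))
  rwa [mul_one]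

lemma uniqueSums_quot (L : AddSubgroup (Fin n → ℤ))
    (h : ∀ (w : Fin n → ℤ) (e : ℕ), 0 < e → e • w ∈ L → w ∈ L) :
    UniqueSums ((Fin n → ℤ) ⧸ L) := by
  have hfin : Module.Finite ℤ ((Fin n → ℤ) ⧸ L) :=
    Module.Finite.of_surjective (QuotientAddGroup.mk' L).toIntLinearMap
      (QuotientAddGroup.mk'_surjective L)
  have htf : IsAddTorsionFree ((Fin n → ℤ) ⧸ L) := by
    constructor
    intro e he x y hxy
    simp only at hxy
    replace hxy : e • (x - y) = 0 := by rw [nsmul_sub, hxy, sub_self]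
    rw [← sub_eq_zero]
    obtain ⟨w, hw⟩ := QuotientAddGroup.mk'_surjective L (x - y)
    rw [← hw] at hxy ⊢
    rw [← map_nsmul] at hxy
    rw [QuotientAddGroup.mk'_apply, QuotientAddGroup.eq_zero_iff] at hxy ⊢
    exact h w e (Nat.pos_of_ne_zero he) hxy
  have hfree : Module.Free ℤ ((Fin n → ℤ) ⧸ L) := Module.free_of_finite_type_torsion_free'
  exact UniqueSums.of_injective_addHom
    ((Module.Free.chooseBasis ℤ ((Fin n → ℤ) ⧸ L)).repr.toLinearMap.toAddHom)
    (Module.Free.chooseBasis ℤ ((Fin n → ℤ) ⧸ L)).repr.injective inferInstance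

lemma normal_form (I : Ideal (MvPolynomial (Fin n) k)) (f : MvPolynomial (Fin n) k) :
    ∃ f', f - f' ∈ I ∧ f'.support ⊆ f.support ∧ (∀ a ∈ f'.support, M k a ∉ I) ∧
      ∀ a ∈ f'.support, ∀ b ∈ f'.support, Cg I a b → b = a := by
  classical
  induction hN : f.support.card using Nat.strong_induction_on generalizing f with
  | _ N ih =>
  subst hN
  by_cases hA : ∃ a ∈ f.support, M k a ∈ I
  · obtain ⟨a, ha, haI⟩ := hA
    have h2 : monomial a (coeff a f) ∈ I := by
      rw [mon_eq]; exact Ideal.mul_mem_left _ _ haI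
    obtain ⟨f', h3, h4, h5⟩ := ih _ (card_support_lt ha) (f - monomial a (coeff a f)) rfl
    refine ⟨f', mem2 h3 h2 1 1 (by ring), h4.trans ?_, h5⟩
    intro b hb
    rw [mem_support_iff, coeff_sub, coeff_monomial] at hb
    rw [mem_support_iff]
    split_ifs at hb with h
    · subst h; simp at hb
    · simpa using hb
  by_cases hB : ∃ a ∈ f.support, ∃ b ∈ f.support, b ≠ a ∧ Cg I a b
  · obtain ⟨a, ha, b, hb, hba, d, hd, h⟩ := hB
    have h2 : C (coeff a f) * (M k a - C d * M k b) ∈ I := Ideal.mul_mem_left _ _ h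
    obtain ⟨f', h3, h4, h5⟩ := ih _ (card_support_lt' ha hb hba d).2
      (f - C (coeff a f) * (M k a - C d * M k b)) rfl
    exact ⟨f', mem2 h3 h2 1 1 (by ring), h4.trans (card_support_lt' ha hb hba d).1, h5⟩
  push Not at hA hB
  refine ⟨f, by simp, subset_rfl, hA, fun a ha b hb h => ?_⟩
  by_contra hne
  exact hB a ha b hb hne h

lemma support_nonempty_of_not_mem {f : MvPolynomial (Fin n) k} (hf : f ∉ I) :
    f.support.Nonempty := by
  rw [Finset.nonempty_iff_ne_empty, Ne, MvPolynomial.support_eq_empty]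
  rintro rfl
  exact hf (zero_mem _)

lemma nz_of_support [IsAlgClosed k] [CharZero k] (hI : IsBinomialIdeal I) (hne : I ≠ ⊤)
    (H2 : ∀ u v, Nz I (M k u) → Nz I (M k v) → ∀ c : k, c ≠ 0 →
      M k u - C c * M k v ∈ I ∨ Nz I (M k u - C c * M k v))
    {f : MvPolynomial (Fin n) k} (hfU : ∀ a ∈ f.support, Nz I (M k a)) (hf : f ∉ I) : Nz I f := by
  classical
  intro g hfg
  by_contra hg
  obtain ⟨f', hf1, hf2, hf3, hf4⟩ := normal_form I f
  obtain ⟨g', hg1, hg2, hg3, hg4⟩ := normal_form I g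
  have hf' : f' ∉ I := fun h => hf (mem2 hf1 h 1 1 (by ring))
  have hg' : g' ∉ I := fun h => hg (mem2 hg1 h 1 1 (by ring))
  have hfg' : f' * g' ∈ I := by
    have h1 : f' * g ∈ I := mem2 hfg hf1 1 (-g) (by ring)
    exact mem2 h1 hg1 1 (-f') (by ring)
  replace hfU : ∀ a ∈ f'.support, Nz I (M k a) := fun a ha => hfU a (hf2 ha)
  have hF := support_nonempty_of_not_mem hf'
  obtain ⟨a0, ha0⟩ := support_nonempty_of_not_mem hg'
  let T : (Fin n →₀ ℕ) → (Fin n →₀ ℕ) → (Fin n →₀ ℕ) → Prop := fun a p q =>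
    Nz I (M k p) ∧ Nz I (M k q) ∧ Cg I (p + a) (q + a0)
  let mk : (Fin n → ℤ) →+ (Fin n → ℤ) ⧸ lat I := QuotientAddGroup.mk' (lat I)
  have hmk : ∀ x y, x - y ∈ lat I → mk x = mk y := by
    intro x y h
    rw [← sub_eq_zero, ← map_sub]
    exact (QuotientAddGroup.eq_zero_iff _).2 h
  have hmk' : ∀ x y, mk x = mk y → x - y ∈ lat I := by
    intro x y h
    rw [← sub_eq_zero, ← map_sub] at h
    exact (QuotientAddGroup.eq_zero_iff _).1 h
  have hwd : ∀ a p q p' q', T a p q → T a p' q' → mk (toZ q - toZ p) = mk (toZ q' - toZ p') := by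
    rintro a p q p' q' ⟨hp, hq, h⟩ ⟨hp', hq', h'⟩
    have h1 : Cg I (a0 + (p' + q)) (a0 + (p + q')) := by
      have e1 := (Cg.refl (I := I) p').add h
      have e2 := (Cg.refl (I := I) p).add h'
      have e3 : p' + (p + a) = p + (p' + a) := by abel
      rw [e3] at e1
      have e4 := e1.symm.trans e2
      convert e4 using 1 <;> abel
    obtain ⟨c, hc, h1⟩ := h1
    have h2 : (M k (p' + q) - C c * M k (p + q')) * M k a0 ∈ I := by
      refine mem1 h1 1 ?_
      rw [M_add a0, M_add a0]; ring
    rcases H2 _ _ (nz_M_add hp' hq) (nz_M_add hp hq') c hc with h3 | h3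
    · apply hmk
      refine mem_lat.2 ⟨p' + q, p + q', nz_M_add hp' hq, nz_M_add hp hq', ⟨c, hc, h3⟩, ?_⟩
      rw [toZ_add, toZ_add]; abel
    · exact absurd (h3 _ h2) (hg3 a0 ha0)
  let d : (Fin n →₀ ℕ) → (Fin n → ℤ) ⧸ lat I := fun a =>
    if h : ∃ p q, T a p q then mk (toZ h.choose_spec.choose - toZ h.choose) else 0
  have hd : ∀ a p q, T a p q → d a = mk (toZ q - toZ p) := by
    intro a p q h
    have hex : ∃ p q, T a p q := ⟨p, q, h⟩
    simp only [d]
    rw [dif_pos hex]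
    exact hwd a _ _ _ _ hex.choose_spec.choose_spec h
  have hUS := uniqueSums_quot (lat I) fun w e he hw => lat_torsion hne H2 he hw
  obtain ⟨x, hx, y, hy, hxy⟩ := hUS.uniqueAdd_of_nonempty
    (A := f'.support.image fun u => mk (toZ u))
    (B := (g'.support.filter fun a => ∃ p q, T a p q).image d)
    (hF.image _) (Finset.Nonempty.image ⟨a0, Finset.mem_filter.2 ⟨ha0, 0, 0, nz_M_zero I,
      nz_M_zero I, Cg.refl _⟩⟩ _)
  obtain ⟨u0, hu0, rfl⟩ := Finset.mem_image.1 hx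
  obtain ⟨a1, ha1, rfl⟩ := Finset.mem_image.1 hy
  obtain ⟨ha1, p, q, hT⟩ := Finset.mem_filter.1 ha1
  have huniq : ∀ u ∈ f'.support, ∀ a ∈ g'.support, Cg I (u0 + a1) (u + a) → u = u0 ∧ a = a1 := by
    intro u hu a ha h
    have hT' : T a (p + u) (q + u0) := by
      refine ⟨nz_M_add hT.1 (hfU u hu), nz_M_add hT.2.1 (hfU u0 hu0), ?_⟩
      have e1 := (Cg.refl (I := I) p).add h.symm
      have e2 := (Cg.refl (I := I) u0).add hT.2.2
      have e3 : p + (u0 + a1) = u0 + (p + a1) := by abel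
      rw [e3] at e1
      have e4 := e1.trans e2
      convert e4 using 1 <;> abel
    have hsum : mk (toZ u) + d a = mk (toZ u0) + d a1 := by
      rw [hd a _ _ hT', hd a1 _ _ hT, ← map_add, ← map_add]
      congr 1
      rw [toZ_add, toZ_add]; abel
    have h3 := hxy (Finset.mem_image.2 ⟨u, hu, rfl⟩)
      (Finset.mem_image.2 ⟨a, Finset.mem_filter.2 ⟨ha, _, _, hT'⟩, rfl⟩) hsum
    have h4 : u = u0 := hf4 u0 hu0 u hu (cg_of_mem_lat (hmk' _ _ h3.1.symm))
    subst h4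
    exact ⟨rfl, hg4 a1 ha1 a ha (h.cancel (hfU u hu))⟩
  have hexp : f' * g' = ∑ z ∈ f'.support ×ˢ g'.support,
      monomial (z.1 + z.2) (coeff z.1 f' * coeff z.2 g') := by
    conv_lhs => rw [← f'.support_sum_monomial_coeff, ← g'.support_sum_monomial_coeff]
    rw [Finset.sum_mul_sum, ← Finset.sum_product']
    exact Finset.sum_congr rfl fun z _ => by rw [monomial_mul]
  have h := proj_mem hI (u0 + a1) hfg'
  rw [hexp, map_sum, Finset.sum_eq_single_of_mem (u0, a1) (Finset.mem_product.2 ⟨hu0, ha1⟩)] at h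
  · rw [proj_monomial, if_pos (Cg.refl _), mon_eq, C_mul_mem_iff (mul_ne_zero
      (mem_support_iff.1 hu0) (mem_support_iff.1 ha1)), M_add] at h
    exact hg3 a1 ha1 (hfU u0 hu0 _ h)
  · rintro ⟨u, a⟩ hz hza
    obtain ⟨hu, ha⟩ := Finset.mem_product.1 hz
    rw [proj_monomial, if_neg]
    intro hcg
    obtain ⟨rfl, rfl⟩ := huniq u hu a ha hcg
    exact hza rfl

lemma isPrimary_of [IsAlgClosed k] [CharZero k] (hI : IsBinomialIdeal I) (hne : I ≠ ⊤)
    (H1 : ∀ u, Nz I (M k u) ∨ ∃ N : ℕ, M k u ^ N ∈ I)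
    (H2 : ∀ u v, Nz I (M k u) → Nz I (M k v) → ∀ c : k, c ≠ 0 →
      M k u - C c * M k v ∈ I ∨ Nz I (M k u - C c * M k v)) : I.IsPrimary := by
  classical
  rw [Ideal.isPrimary_iff]
  refine ⟨hne, fun {x y} hxy => ?_⟩
  by_contra! hcon
  obtain ⟨hx, hy⟩ := hcon
  set y1 := ∑ a ∈ y.support.filter (fun a => Nz I (M k a)), monomial a (coeff a y) with hy1
  set y2 := ∑ a ∈ y.support.filter (fun a => ¬ Nz I (M k a)), monomial a (coeff a y) with hy2
  have hsum : y = y1 + y2 := by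
    rw [hy1, hy2, Finset.sum_filter_add_sum_filter_not, y.support_sum_monomial_coeff]
  have hy2r : y2 ∈ I.radical := by
    refine sum_mem fun a ha => ?_
    rw [mon_eq]
    refine Ideal.mul_mem_left _ _ ?_
    rcases H1 a with h | ⟨N, h⟩
    · exact absurd h (Finset.mem_filter.1 ha).2
    · exact ⟨N, h⟩
  have hy1I : y1 ∉ I := fun h => hy (by rw [hsum]; exact add_mem (Ideal.le_radical h) hy2r)
  have hy1U : ∀ a ∈ y1.support, Nz I (M k a) := by
    intro a ha
    obtain ⟨b, hb, hab⟩ := Finset.mem_biUnion.1 (support_sum ha)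
    have := support_monomial_subset hab
    rw [Finset.mem_singleton] at this
    subst this
    exact (Finset.mem_filter.1 hb).2
  have hnz := nz_of_support hI hne H2 hy1U hy1I
  have hall : ∀ N : ℕ, y2 ^ N * x ∉ I := by
    intro N
    induction N with
    | zero => simpa using hx
    | succ N ih =>
      intro h
      refine ih (hnz _ (mem2 hxy h (y2 ^ N) (-1) ?_))
      rw [hsum]; ring
  obtain ⟨N, hN⟩ := hy2r
  exact hall N (I.mul_mem_right _ hN)

lemma good_or_primary [IsAlgClosed k] [CharZero k] (hI : IsBinomialIdeal I) (hne : I ≠ ⊤) :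
    I.IsPrimary ∨ Good I := by
  by_cases hG : Good I
  · exact Or.inr hG
  refine Or.inl (isPrimary_of hI hne (fun u => ?_) (fun u v hu hv c hc => ?_))
  · by_contra! h
    exact hG (good_of_monomial hI u h.1 h.2)
  · by_contra! h
    exact hG (good_of_binomial hI hu hv hc h.1 h.2)

lemma exists_dec [IsAlgClosed k] [CharZero k] (I : Ideal (MvPolynomial (Fin n) k)) :
    IsBinomialIdeal I → ∃ s : Finset (Ideal (MvPolynomial (Fin n) k)),
      (∀ Q ∈ s, Q.IsPrimary ∧ IsBinomialIdeal Q) ∧ I = s.inf id := by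
  classical
  refine IsNoetherian.induction (P := fun I : Ideal (MvPolynomial (Fin n) k) =>
    IsBinomialIdeal I → ∃ s : Finset (Ideal (MvPolynomial (Fin n) k)),
      (∀ Q ∈ s, Q.IsPrimary ∧ IsBinomialIdeal Q) ∧ I = s.inf id) ?_ I
  intro I ih hI
  by_cases hne : I = ⊤
  · exact ⟨∅, by simp, by simpa using hne⟩
  rcases good_or_primary hI hne with h | ⟨s, hs, hsI⟩
  · exact ⟨{I}, by simpa using ⟨h, hI⟩, by simp⟩
  · choose! t ht htJ using fun J (hJ : J ∈ s) => ih J (hs J hJ).2 (hs J hJ).1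
    refine ⟨s.biUnion t, ?_, ?_⟩
    · intro Q hQ
      obtain ⟨J, hJ, hQ⟩ := Finset.mem_biUnion.1 hQ
      exact ht J hJ Q hQ
    · rw [Finset.inf_biUnion]
      conv_lhs => rw [hsI]
      exact Finset.inf_congr rfl fun J hJ => htJ J hJ

end primary

end BinPD

/-- Over an algebraically closed field of characteristic zero, every binomial ideal has a
primary decomposition into binomial ideals. -/
theorem binomial_primary_decomposition_exists
    {k : Type*} [Field k] [IsAlgClosed k] [CharZero k] {n : ℕ}
    (I : Ideal (MvPolynomial (Fin n) k)) (hbin : IsBinomialIdeal I) :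
    ∃ (r : ℕ) (Q : Fin r → Ideal (MvPolynomial (Fin n) k)),
      (∀ j : Fin r, (Q j).IsPrimary ∧ IsBinomialIdeal (Q j)) ∧
      I = ⨅ j : Fin r, Q j := by
  obtain ⟨s, hs, h⟩ := BinPD.exists_dec I hbin
  refine ⟨s.card, fun j => (s.equivFin.symm j : Ideal (MvPolynomial (Fin n) k)),
    fun j => hs _ (s.equivFin.symm j).2, ?_⟩
  rw [h]
  refine le_antisymm (le_iInf fun j => Finset.inf_le (f := id) (s.equivFin.symm j).2)
    (Finset.le_inf fun P hP => (iInf_le _ (s.equivFin ⟨P, hP⟩)).trans (by simp))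
end

section
/- The commuting birth and death ideal I^{(2,3)} ⊆ ℚ[R,L,D,U] (for the 2×3 grid) is not a radical ideal. -/
open MvPolynomial

/-- Names of the grid variables: right, left, down and up moves starting at
a given grid position. -/
inductive BDName where
  | R : ℕ → ℕ → BDName
  | L : ℕ → ℕ → BDName
  | D : ℕ → ℕ → BDName
  | U : ℕ → ℕ → BDName

/-- The set of variables of the commuting birth and death ideal on the `n₁ × n₂` grid:
`R i j` for `0 ≤ i < n₁`, `0 ≤ j ≤ n₂`; `L i j` for `0 < i ≤ n₁`, `0 ≤ j ≤ n₂`;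
`D i j` for `0 ≤ i ≤ n₁`, `0 < j ≤ n₂`; `U i j` for `0 ≤ i ≤ n₁`, `0 ≤ j < n₂`. -/
def BDVars (n₁ n₂ : ℕ) : Set BDName := fun v =>
  match v with
  | .R i j => i < n₁ ∧ j ≤ n₂
  | .L i j => 0 < i ∧ i ≤ n₁ ∧ j ≤ n₂
  | .D i j => i ≤ n₁ ∧ 0 < j ∧ j ≤ n₂
  | .U i j => i ≤ n₁ ∧ j < n₂

/-- The commuting birth and death ideal `I^{(n₁,n₂)}`, generated for each unit square with
lower-left corner `(u,v)` by the four binomials expressing commutativity of the moves. -/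
noncomputable def cbdIdeal (n₁ n₂ : ℕ) : Ideal (MvPolynomial (BDVars n₁ n₂) ℚ) :=
  Ideal.span {f | ∃ (u v : ℕ) (hu : u < n₁) (hv : v < n₂),
    f = X ⟨.U u v, hu.le, hv⟩ * X ⟨.R u (v+1), hu, hv⟩ -
        X ⟨.R u v, hu, hv.le⟩ * X ⟨.U (u+1) v, hu, hv⟩ ∨
    f = X ⟨.D u (v+1), hu.le, v.succ_pos, hv⟩ * X ⟨.R u v, hu, hv.le⟩ -
        X ⟨.R u (v+1), hu, hv⟩ * X ⟨.D (u+1) (v+1), hu, v.succ_pos, hv⟩ ∨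
    f = X ⟨.L (u+1) (v+1), u.succ_pos, hu, hv⟩ * X ⟨.D u (v+1), hu.le, v.succ_pos, hv⟩ -
        X ⟨.D (u+1) (v+1), hu, v.succ_pos, hv⟩ * X ⟨.L (u+1) v, u.succ_pos, hu, hv.le⟩ ∨
    f = X ⟨.L (u+1) v, u.succ_pos, hu, hv.le⟩ * X ⟨.U u v, hu.le, hv⟩ -
        X ⟨.U (u+1) v, hu, hv⟩ * X ⟨.L (u+1) (v+1), u.succ_pos, hu, hv⟩}

/-- The nilpotency certificate: in any commutative ring in which the listed square relations
hold, the binomial `a - b` squares to zero. -/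
theorem bd_sq_zero {A : Type*} [CommRing A] (D01 D03 D11 D13 D21 D23 L10 L11 L12 L21 L22 L23 R01 R02 R03 R10 R11 R12 U01 U11 U21 : A)
    (h002 : L11 * D01 = D11 * L10)
    (h010 : U01 * R02 = R01 * U11)
    (h013 : L11 * U01 = U11 * L12)
    (h021 : D03 * R02 = R03 * D13)
    (h101 : D11 * R10 = R11 * D21)
    (h110 : U11 * R12 = R11 * U21)
    (h113 : L21 * U11 = U21 * L22)
    (h122 : L23 * D13 = D23 * L22) :
    (D11 * U01 * D23 * R03 * L10 * R10 * L21 - D11 * U21 * D03 * R01 * L10 * R10 * L23) ^ 2 = 0 := by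
  linear_combination
    - D11 * D23 * D23 * L10 * L21 * L21 * R03 * R03 * R10 * R10 * U01 * U01 * h002
    + D01 * D11 * D23 * D23 * L10 * L21 * L21 * R03 * R03 * R10 * R10 * U01 * h013
    + D01 * D11 * D23 * D23 * L10 * L12 * L21 * R03 * R03 * R10 * R10 * U01 * h113
    - D01 * D11 * D23 * L10 * L12 * L21 * R03 * R03 * R10 * R10 * U01 * U21 * h122
    - D01 * D11 * D23 * L10 * L12 * L21 * L23 * R03 * R10 * R10 * U01 * U21 * h021
    + D01 * D03 * D11 * D23 * L10 * L12 * L21 * L23 * R03 * R10 * R10 * U21 * h010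
    - D01 * D03 * D11 * D23 * L10 * L21 * L23 * R01 * R03 * R10 * R10 * U21 * h013
    + D03 * D11 * D23 * L10 * L21 * L23 * R01 * R03 * R10 * R10 * U01 * U21 * h002
    - D03 * D11 * D23 * L10 * L10 * L21 * L23 * R01 * R03 * R10 * U01 * U21 * h101
    + D03 * D11 * D21 * D23 * L10 * L10 * L21 * L23 * R01 * R03 * R10 * U01 * h110
    - D03 * D11 * D21 * D23 * L10 * L10 * L23 * R01 * R03 * R10 * R12 * U01 * h113
    + D03 * D11 * D21 * L10 * L10 * L23 * R01 * R03 * R10 * R12 * U01 * U21 * h122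
    + D03 * D11 * D21 * L10 * L10 * L23 * L23 * R01 * R10 * R12 * U01 * U21 * h021
    - D03 * D03 * D11 * D21 * L10 * L10 * L23 * L23 * R01 * R10 * R12 * U21 * h010
    - D03 * D03 * D11 * D21 * L10 * L10 * L23 * L23 * R01 * R01 * R10 * U21 * h110
    + D03 * D03 * D11 * L10 * L10 * L23 * L23 * R01 * R01 * R10 * U21 * U21 * h101

/-- Numerical codes for the variables. -/
def bdCode : BDName → ℕ
  | .R i j => 4 * i + j
  | .L i j => 16 + (4 * i + j)
  | .D i j => 32 + (4 * i + j)
  | .U i j => 48 + (4 * i + j)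

/-- The (finite) congruence class of the monomial `a`, in codes. -/
def bdClass : List (Multiset ℕ) :=
  [{3, 4, 20, 25, 37, 43, 49},
   {3, 4, 21, 25, 33, 43, 49},
   {3, 5, 20, 25, 41, 43, 49},
   {3, 4, 20, 24, 41, 43, 49},
   {3, 4, 22, 25, 33, 43, 53},
   {3, 4, 22, 26, 33, 43, 57},
   {3, 4, 22, 27, 33, 39, 57},
   {2, 4, 22, 27, 33, 35, 57},
   {3, 4, 23, 27, 33, 35, 57}]

/-- The four moves in the square with lower-left corner `(u,v)`, in codes. -/
def bdMoves (u v : ℕ) : List (Multiset ℕ × Multiset ℕ) :=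
  [({bdCode (.U u v), bdCode (.R u (v+1))}, {bdCode (.R u v), bdCode (.U (u+1) v)}),
   ({bdCode (.D u (v+1)), bdCode (.R u v)}, {bdCode (.R u (v+1)), bdCode (.D (u+1) (v+1))}),
   ({bdCode (.L (u+1) (v+1)), bdCode (.D u (v+1))},
     {bdCode (.D (u+1) (v+1)), bdCode (.L (u+1) v)}),
   ({bdCode (.L (u+1) v), bdCode (.U u v)}, {bdCode (.U (u+1) v), bdCode (.L (u+1) (v+1))})]

theorem bdClass_closed : ∀ u < 2, ∀ v < 3, ∀ e ∈ bdMoves u v, ∀ m ∈ bdClass,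
    (e.1 ≤ m → m - e.1 + e.2 ∈ bdClass) ∧ (e.2 ≤ m → m - e.2 + e.1 ∈ bdClass) := by
  intro u hu v hv
  interval_cases u <;> interval_cases v <;> decide +kernel

theorem bdClass_iff {u v : ℕ} (hu : u < 2) (hv : v < 3) {e : Multiset ℕ × Multiset ℕ}
    (he : e ∈ bdMoves u v) (s : Multiset ℕ) : s + e.1 ∈ bdClass ↔ s + e.2 ∈ bdClass := by
  constructor
  · intro h
    have := (bdClass_closed u hu v hv e he _ h).1 (Multiset.le_add_left _ _)
    rwa [Multiset.add_sub_cancel_right] at this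
  · intro h
    have := (bdClass_closed u hu v hv e he _ h).2 (Multiset.le_add_left _ _)
    rwa [Multiset.add_sub_cancel_right] at this

/-- The code multiset of an exponent vector. -/
noncomputable def bdExp (s : BDVars 2 3 →₀ ℕ) : Multiset ℕ :=
  (Finsupp.toMultiset s).map fun v => bdCode v.1

/-- The linear functional summing the coefficients over the class. -/
noncomputable def bdFun : MvPolynomial (BDVars 2 3) ℚ →ₗ[ℚ] ℚ :=
  (basisMonomials (BDVars 2 3) ℚ).constr ℚ fun s => if bdExp s ∈ bdClass then 1 else 0

theorem bdFun_monomial (s : BDVars 2 3 →₀ ℕ) :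
    bdFun (monomial s 1) = if bdExp s ∈ bdClass then 1 else 0 := by
  have := (basisMonomials (BDVars 2 3) ℚ).constr_basis ℚ
    (fun s => if bdExp s ∈ bdClass then (1 : ℚ) else 0) s
  rwa [coe_basisMonomials] at this

theorem bdFun_gen (a b c d : BDVars 2 3)
    (H : ∀ s : Multiset ℕ, s + {bdCode a.1, bdCode b.1} ∈ bdClass ↔
      s + {bdCode c.1, bdCode d.1} ∈ bdClass) (p : MvPolynomial (BDVars 2 3) ℚ) :
    bdFun (p * (X a * X b - X c * X d)) = 0 := by
  induction p using MvPolynomial.induction_on' with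
  | add p q hp hq => rw [add_mul, map_add, hp, hq, add_zero]
  | monomial s r =>
    have key : ∀ x y : BDVars 2 3, monomial s r * (X x * X y) =
        r • monomial (s + (Finsupp.single x 1 + Finsupp.single y 1)) (1 : ℚ) := by
      intro x y
      simp [X, monomial_mul, smul_monomial]
    have key2 : ∀ x y : BDVars 2 3, bdExp (s + (Finsupp.single x 1 + Finsupp.single y 1)) =
        bdExp s + {bdCode x.1, bdCode y.1} := by
      intro x y
      simp [bdExp, Finsupp.toMultiset_single]
    rw [mul_sub, key, key, map_sub, map_smul, map_smul, bdFun_monomial, bdFun_monomial,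
      key2, key2]
    simp only [H, sub_self]

theorem bdFun_zero {f : MvPolynomial (BDVars 2 3) ℚ} (hf : f ∈ cbdIdeal 2 3) :
    bdFun f = 0 := by
  unfold cbdIdeal at hf
  refine Submodule.closure_induction (p := fun x _ => bdFun x = 0) (map_zero _) ?_ ?_ hf
  · intro x y _ _ hx hy
    rw [map_add, hx, hy, add_zero]
  · rintro p x ⟨u, v, hu, hv, rfl | rfl | rfl | rfl⟩ <;> rw [smul_eq_mul] <;>
      apply bdFun_gen <;> intro s
    · exact bdClass_iff hu hv (e := (_, _)) (List.mem_cons_self ..) s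
    · exact bdClass_iff hu hv (e := (_, _)) (.tail _ (.head _)) s
    · exact bdClass_iff hu hv (e := (_, _)) (.tail _ (.tail _ (.head _))) s
    · exact bdClass_iff hu hv (e := (_, _)) (.tail _ (.tail _ (.tail _ (.head _)))) s

/-- The variables as elements of the quotient ring. -/
noncomputable def bdq (v : BDVars 2 3) : MvPolynomial (BDVars 2 3) ℚ ⧸ cbdIdeal 2 3 :=
  Ideal.Quotient.mk _ (X v)

theorem bdq_rel {a b c d : BDVars 2 3} (h : X a * X b - X c * X d ∈ cbdIdeal 2 3) :
    bdq a * bdq b = bdq c * bdq d := by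
  simp only [bdq, ← map_mul]
  exact Ideal.Quotient.eq.2 h

theorem bdq_rel0 (u v : ℕ) (hu : u < 2) (hv : v < 3) :
    bdq ⟨.U u v, hu.le, hv⟩ * bdq ⟨.R u (v+1), hu, hv⟩ =
      bdq ⟨.R u v, hu, hv.le⟩ * bdq ⟨.U (u+1) v, hu, hv⟩ :=
  bdq_rel (Ideal.subset_span ⟨u, v, hu, hv, Or.inl rfl⟩)

theorem bdq_rel1 (u v : ℕ) (hu : u < 2) (hv : v < 3) :
    bdq ⟨.D u (v+1), hu.le, v.succ_pos, hv⟩ * bdq ⟨.R u v, hu, hv.le⟩ =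
      bdq ⟨.R u (v+1), hu, hv⟩ * bdq ⟨.D (u+1) (v+1), hu, v.succ_pos, hv⟩ :=
  bdq_rel (Ideal.subset_span ⟨u, v, hu, hv, Or.inr (Or.inl rfl)⟩)

theorem bdq_rel2 (u v : ℕ) (hu : u < 2) (hv : v < 3) :
    bdq ⟨.L (u+1) (v+1), u.succ_pos, hu, hv⟩ * bdq ⟨.D u (v+1), hu.le, v.succ_pos, hv⟩ =
      bdq ⟨.D (u+1) (v+1), hu, v.succ_pos, hv⟩ * bdq ⟨.L (u+1) v, u.succ_pos, hu, hv.le⟩ :=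
  bdq_rel (Ideal.subset_span ⟨u, v, hu, hv, Or.inr (Or.inr (Or.inl rfl))⟩)

theorem bdq_rel3 (u v : ℕ) (hu : u < 2) (hv : v < 3) :
    bdq ⟨.L (u+1) v, u.succ_pos, hu, hv.le⟩ * bdq ⟨.U u v, hu.le, hv⟩ =
      bdq ⟨.U (u+1) v, hu, hv⟩ * bdq ⟨.L (u+1) (v+1), u.succ_pos, hu, hv⟩ :=
  bdq_rel (Ideal.subset_span ⟨u, v, hu, hv, Or.inr (Or.inr (Or.inr rfl))⟩)

/-- Product of seven variables. -/
noncomputable def bdProd (a b c d e f g : BDVars 2 3) : MvPolynomial (BDVars 2 3) ℚ :=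
  X a * X b * X c * X d * X e * X f * X g

theorem bdFun_prod (a b c d e f g : BDVars 2 3) : bdFun (bdProd a b c d e f g) =
    if ({bdCode a.1, bdCode b.1, bdCode c.1, bdCode d.1, bdCode e.1, bdCode f.1,
      bdCode g.1} : Multiset ℕ) ∈ bdClass then 1 else 0 := by
  have h : bdProd a b c d e f g = monomial (Finsupp.single a 1 + Finsupp.single b 1 +
      Finsupp.single c 1 + Finsupp.single d 1 + Finsupp.single e 1 + Finsupp.single f 1 +
      Finsupp.single g 1) 1 := by
    simp [bdProd, X, monomial_mul]
  rw [h, bdFun_monomial]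
  congr 2
  simp [bdExp, Finsupp.toMultiset_single]

/-- The commuting birth and death ideal `I^{(2,3)}` is not radical. -/
theorem cbdIdeal_two_three_not_radical : ¬ (cbdIdeal 2 3).IsRadical := by
  intro hrad
  have hsq := bd_sq_zero
    (bdq ⟨.D 0 1, by decide, by decide, by decide⟩)
    (bdq ⟨.D 0 3, by decide, by decide, by decide⟩)
    (bdq ⟨.D 1 1, by decide, by decide, by decide⟩)
    (bdq ⟨.D 1 3, by decide, by decide, by decide⟩)
    (bdq ⟨.D 2 1, by decide, by decide, by decide⟩)
    (bdq ⟨.D 2 3, by decide, by decide, by decide⟩)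
    (bdq ⟨.L 1 0, by decide, by decide, by decide⟩)
    (bdq ⟨.L 1 1, by decide, by decide, by decide⟩)
    (bdq ⟨.L 1 2, by decide, by decide, by decide⟩)
    (bdq ⟨.L 2 1, by decide, by decide, by decide⟩)
    (bdq ⟨.L 2 2, by decide, by decide, by decide⟩)
    (bdq ⟨.L 2 3, by decide, by decide, by decide⟩)
    (bdq ⟨.R 0 1, by decide, by decide⟩)
    (bdq ⟨.R 0 2, by decide, by decide⟩)
    (bdq ⟨.R 0 3, by decide, by decide⟩)
    (bdq ⟨.R 1 0, by decide, by decide⟩)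
    (bdq ⟨.R 1 1, by decide, by decide⟩)
    (bdq ⟨.R 1 2, by decide, by decide⟩)
    (bdq ⟨.U 0 1, by decide, by decide⟩)
    (bdq ⟨.U 1 1, by decide, by decide⟩)
    (bdq ⟨.U 2 1, by decide, by decide⟩)
    (bdq_rel2 0 0 (by decide) (by decide))
    (bdq_rel0 0 1 (by decide) (by decide))
    (bdq_rel3 0 1 (by decide) (by decide))
    (bdq_rel1 0 2 (by decide) (by decide))
    (bdq_rel1 1 0 (by decide) (by decide))
    (bdq_rel0 1 1 (by decide) (by decide))
    (bdq_rel3 1 1 (by decide) (by decide))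
    (bdq_rel2 1 2 (by decide) (by decide))
  have hmem : bdProd ⟨.D 1 1, by decide, by decide, by decide⟩
    ⟨.U 0 1, by decide, by decide⟩
    ⟨.D 2 3, by decide, by decide, by decide⟩
    ⟨.R 0 3, by decide, by decide⟩
    ⟨.L 1 0, by decide, by decide, by decide⟩
    ⟨.R 1 0, by decide, by decide⟩
    ⟨.L 2 1, by decide, by decide, by decide⟩ -
      bdProd ⟨.D 1 1, by decide, by decide, by decide⟩
    ⟨.U 2 1, by decide, by decide⟩
    ⟨.D 0 3, by decide, by decide, by decide⟩
    ⟨.R 0 1, by decide, by decide⟩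
    ⟨.L 1 0, by decide, by decide, by decide⟩
    ⟨.R 1 0, by decide, by decide⟩
    ⟨.L 2 3, by decide, by decide, by decide⟩ ∈
      cbdIdeal 2 3 := by
    apply hrad
    refine ⟨2, ?_⟩
    rw [← Ideal.Quotient.eq_zero_iff_mem]
    simpa only [bdProd, bdq, map_pow, map_sub, map_mul] using hsq
  have h0 := bdFun_zero hmem
  rw [map_sub, bdFun_prod, bdFun_prod, if_pos (by decide +kernel), if_neg (by decide +kernel)] at h0
  norm_num at h0
end

section
/- For every n ∈ {1, 2, 3, 4, 5, 6}, the commuting birth and death ideal I^{(1,n)} ⊆ ℚ[R,L,D,U] is a radical ideal. -/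
open MvPolynomial

/-! ## Abstract token model -/

/-- Tokens: `R j`, `L j` at row `j`, and `G v k e` in the gap between rows `v` and `v+1`,
of type `k` and state `e`. -/
inductive Tok where
  | R : ℕ → Tok
  | L : ℕ → Tok
  | G : ℕ → Bool → Bool → Tok

noncomputable instance : DecidableEq Tok := Classical.decEq _

namespace Tok

/-- The ideal of all token moves. -/
noncomputable def tIdeal : Ideal (MvPolynomial Tok ℚ) :=
  Ideal.span {f | ∃ (v : ℕ) (k : Bool),
    f = X (G v k false) * X (R (v+1)) - X (G v k true) * X (R v) ∨
    f = X (G v k false) * X (L v) - X (G v k true) * X (L (v+1))}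

/-- The rational points of the variety, as a monoid. -/
def pts : Submonoid (Tok → ℚ) where
  carrier := {x | ∀ v k, x (G v k false) * x (R (v+1)) = x (G v k true) * x (R v) ∧
    x (G v k false) * x (L v) = x (G v k true) * x (L (v+1))}
  one_mem' := by intro v k; simp
  mul_mem' := by
    intro x y hx hy v k
    obtain ⟨h1, h2⟩ := hx v k
    obtain ⟨h3, h4⟩ := hy v k
    simp only [Pi.mul_apply]
    constructor
    · calc _ = (x (G v k false) * x (R (v+1))) * (y (G v k false) * y (R (v+1))) := by ring
        _ = _ := by rw [h1, h3]; ring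
    · calc _ = (x (G v k false) * x (L v)) * (y (G v k false) * y (L v)) := by ring
        _ = _ := by rw [h2, h4]; ring

theorem eval_tIdeal (x : pts) (f : MvPolynomial Tok ℚ) (hf : f ∈ tIdeal) :
    eval (x : Tok → ℚ) f = 0 := by
  have : tIdeal ≤ RingHom.ker (eval (x : Tok → ℚ)) := by
    refine Ideal.span_le.2 ?_
    rintro f ⟨v, k, rfl | rfl⟩
    · simp [RingHom.mem_ker, (x.2 v k).1]
    · simp [RingHom.mem_ker, (x.2 v k).2]
  exact this hf

/-- Evaluation of a monomial as a character of the monoid of points. -/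
noncomputable def ev (s : Tok →₀ ℕ) : pts →* ℚ where
  toFun x := s.prod fun i k => (x : Tok → ℚ) i ^ k
  map_one' := by simp [Finsupp.prod]
  map_mul' x y := by simp [Finsupp.prod, mul_pow, Finset.prod_mul_distrib]

theorem eval_monomial_eq (s : Tok →₀ ℕ) (c : ℚ) (x : pts) :
    eval (x : Tok → ℚ) (monomial s c) = c * ev s x := by
  simp [eval_monomial, ev]

/-- Congruence of exponent vectors modulo the ideal. -/
def Rel (s t : Tok →₀ ℕ) : Prop := monomial s (1 : ℚ) - monomial t 1 ∈ tIdeal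

theorem Rel.refl (s : Tok →₀ ℕ) : Rel s s := by simp [Rel]
theorem Rel.symm {s t : Tok →₀ ℕ} (h : Rel s t) : Rel t s := by
  have := tIdeal.neg_mem h
  rwa [neg_sub] at this
theorem Rel.trans {s t u : Tok →₀ ℕ} (h : Rel s t) (h' : Rel t u) : Rel s u := by
  have := tIdeal.add_mem h h'
  rwa [sub_add_sub_cancel] at this
theorem Rel.add {s t : Tok →₀ ℕ} (u : Tok →₀ ℕ) (h : Rel s t) : Rel (u + s) (u + t) := by
  have := tIdeal.mul_mem_left (monomial u 1) h
  rwa [mul_sub, monomial_mul, monomial_mul, one_mul] at this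

theorem Rel.ev_eq {s t : Tok →₀ ℕ} (h : Rel s t) : ev s = ev t := by
  ext x
  have := eval_tIdeal x _ h
  rw [map_sub, eval_monomial_eq, eval_monomial_eq] at this
  linarith

theorem radical_of (H : ∀ s t, ev s = ev t → Rel s t) : tIdeal.IsRadical := by
  rintro f ⟨m, hm⟩
  have h0 : ∀ x : pts, eval (x : Tok → ℚ) f = 0 := by
    intro x
    have := eval_tIdeal x _ hm
    rw [map_pow] at this
    have h' : (eval (x : Tok → ℚ) f) ^ (m + 1) = 0 := by rw [pow_succ, this, zero_mul]
    exact (pow_eq_zero_iff (by omega)).1 h'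
  let h : (pts →* ℚ) →₀ ℚ := ∑ s ∈ f.support, Finsupp.single (ev s) (f.coeff s)
  have hh : h = 0 := by
    have li := linearIndependent_monoidHom pts ℚ
    rw [linearIndependent_iff] at li
    apply li
    simp only [h, map_sum, Finsupp.linearCombination_single]
    funext x
    have := h0 x
    rw [f.as_sum, map_sum] at this
    simp only [eval_monomial_eq] at this
    simpa [Finset.sum_apply] using this
  let g : (pts →* ℚ) → (Tok →₀ ℕ) := Function.invFun ev
  have hg : ∀ s, Rel s (g (ev s)) := fun s =>
    H _ _ (Function.invFun_eq (f := ev) ⟨s, rfl⟩).symm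
  have h1 : ∑ s ∈ f.support, f.coeff s • (monomial (g (ev s)) (1:ℚ)) = 0 := by
    have := congrArg (Finsupp.linearCombination ℚ (fun χ => monomial (g χ) (1:ℚ))) hh
    simpa only [h, map_sum, Finsupp.linearCombination_single, map_zero] using this
  have h2 : f = ∑ s ∈ f.support, f.coeff s • (monomial s (1:ℚ) - monomial (g (ev s)) 1) := by
    simp only [smul_sub, Finset.sum_sub_distrib, h1, sub_zero]
    conv_lhs => rw [f.as_sum]
    refine Finset.sum_congr rfl fun s _ => ?_
    rw [smul_monomial, smul_eq_mul, mul_one]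
  rw [h2]
  refine Submodule.sum_mem _ fun s _ => ?_
  rw [smul_eq_C_mul]
  exact tIdeal.mul_mem_left _ (hg s)

/-! ### Weights and characters -/

/-- Weighted count. -/
noncomputable def W (w : Tok → ℕ) (s : Tok →₀ ℕ) : ℕ := s.sum fun i k => k * w i

theorem W_add (w : Tok → ℕ) (s t) : W w (s + t) = W w s + W w t := by
  unfold W
  rw [Finsupp.sum_add_index'] <;> intros <;> simp [add_mul]

theorem W_single (w : Tok → ℕ) (i) : W w (Finsupp.single i 1) = w i := by
  simp [W]

theorem W_fadd (w w' : Tok → ℕ) (s) : W (fun i => w i + w' i) s = W w s + W w' s := by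
  simp [W, Finsupp.sum, mul_add, Finset.sum_add_distrib]

theorem W_ind (j : Tok) (s) : W (fun i => if i = j then 1 else 0) s = s j := by
  simp only [W, Finsupp.sum, mul_ite, mul_one, mul_zero, Finset.sum_ite_eq', Finsupp.mem_support_iff]
  split_ifs <;> omega

theorem W_zero {w : Tok → ℕ} {s : Tok →₀ ℕ} (h : ∀ i, s i ≠ 0 → w i = 0) : W w s = 0 := by
  refine Finset.sum_eq_zero fun i hi => ?_
  simp [h i (by simpa using hi)]

theorem char_eq (F : Tok → Prop) (w : Tok → ℕ)
    (h1 : ∀ v k, F (G v k false) ∧ F (R (v+1)) ↔ F (G v k true) ∧ F (R v))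
    (h2 : ∀ v k, F (G v k false) ∧ F (L v) ↔ F (G v k true) ∧ F (L (v+1)))
    (h3 : ∀ v k, F (G v k false) → F (R (v+1)) →
      w (G v k false) + w (R (v+1)) = w (G v k true) + w (R v))
    (h4 : ∀ v k, F (G v k false) → F (L v) →
      w (G v k false) + w (L v) = w (G v k true) + w (L (v+1)))
    {s t : Tok →₀ ℕ} (hs : ∀ i, s i ≠ 0 → F i) (ht : ∀ i, t i ≠ 0 → F i)
    (h : ev s = ev t) : W w s = W w t := by
  classical
  let x : Tok → ℚ := fun i => if F i then 2 ^ w i else 0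
  have key : ∀ a b c d : Tok, (F a ∧ F b ↔ F c ∧ F d) →
      (F a → F b → w a + w b = w c + w d) → x a * x b = x c * x d := by
    intro a b c d hab hw
    by_cases hF : F a ∧ F b
    · have hF' := hab.1 hF
      simp only [x, hF.1, hF.2, hF'.1, hF'.2, if_true, ← pow_add, hw hF.1 hF.2]
    · have hF' : ¬ (F c ∧ F d) := fun h => hF (hab.2 h)
      have e1 : x a * x b = 0 := by
        simp only [x]; split_ifs <;> simp_all
      have e2 : x c * x d = 0 := by
        simp only [x]; split_ifs <;> simp_all
      rw [e1, e2]
  have hx : x ∈ pts := fun v k => ⟨key _ _ _ _ (h1 v k) (h3 v k), key _ _ _ _ (h2 v k) (h4 v k)⟩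
  have val : ∀ u : Tok →₀ ℕ, (∀ i, u i ≠ 0 → F i) → ev u ⟨x, hx⟩ = 2 ^ W w u := by
    intro u hu
    simp only [ev, MonoidHom.coe_mk, OneHom.coe_mk, W, Finsupp.prod, Finsupp.sum]
    rw [← Finset.prod_pow_eq_pow_sum]
    refine Finset.prod_congr rfl fun i hi => ?_
    simp only [x, if_pos (hu i (by simpa using hi)), ← pow_mul, mul_comm]
  have := DFunLike.congr_fun h ⟨x, hx⟩
  rw [val s hs, val t ht] at this
  exact pow_right_injective₀ (by norm_num) (by norm_num) this

theorem char_full (w : Tok → ℕ)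
    (h3 : ∀ v k, w (G v k false) + w (R (v+1)) = w (G v k true) + w (R v))
    (h4 : ∀ v k, w (G v k false) + w (L v) = w (G v k true) + w (L (v+1)))
    {s t : Tok →₀ ℕ} (h : ev s = ev t) : W w s = W w t :=
  char_eq (fun _ => True) w (by simp) (by simp) (fun v k _ _ => h3 v k) (fun v k _ _ => h4 v k)
    (by simp) (by simp) h

/-! ### Moves -/

/-- The exponent vector of one token. -/
noncomputable abbrev e (i : Tok) : Tok →₀ ℕ := Finsupp.single i 1

theorem moveR (v k) : Rel (e (G v k false) + e (R (v+1))) (e (G v k true) + e (R v)) := by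
  refine Ideal.subset_span ⟨v, k, Or.inl ?_⟩
  simp [X, monomial_mul, e]

theorem moveL (v k) : Rel (e (G v k false) + e (L v)) (e (G v k true) + e (L (v+1))) := by
  refine Ideal.subset_span ⟨v, k, Or.inr ?_⟩
  simp [X, monomial_mul, e]

theorem split1 {s : Tok →₀ ℕ} {a : Tok} (ha : s a ≠ 0) : ∃ u, s = u + e a := by
  refine ⟨s - e a, ?_⟩
  rw [tsub_add_cancel_of_le]
  simpa [e] using Nat.one_le_iff_ne_zero.2 ha

theorem split2 {s : Tok →₀ ℕ} {a b : Tok} (hab : a ≠ b) (ha : s a ≠ 0) (hb : s b ≠ 0) :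
    ∃ u, s = u + (e a + e b) := by
  obtain ⟨u, rfl⟩ := split1 hb
  have : u a ≠ 0 := by simpa [e, Finsupp.single_apply, hab.symm] using ha
  obtain ⟨u', rfl⟩ := split1 this
  exact ⟨u', by rw [add_assoc]⟩

/-- Gap `v` has a token in state `b`. -/
def has (s : Tok →₀ ℕ) (v : ℕ) (b : Bool) : Prop := ∃ k, s (G v k b) ≠ 0

/-- Support closure (R part, L part). -/
def cl (s : Tok →₀ ℕ) : ℕ → Prop × Prop
  | 0 => (s (R 0) ≠ 0, s (L 0) ≠ 0)
  | i+1 => (s (R (i+1)) ≠ 0 ∨ ((cl s i).1 ∧ (has s i true ∨ ((cl s i).2 ∧ has s i false))),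
            s (L (i+1)) ≠ 0 ∨ ((cl s i).2 ∧ (has s i false ∨ ((cl s i).1 ∧ has s i true))))

theorem cl_congr {s t : Tok →₀ ℕ} (i : ℕ) (hR : ∀ j ≤ i, s (R j) = t (R j))
    (hL : ∀ j ≤ i, s (L j) = t (L j)) (hG : ∀ v < i, ∀ k b, s (G v k b) = t (G v k b)) :
    cl s i = cl t i := by
  induction i with
  | zero => simp [cl, hR, hL]
  | succ i ih =>
    have := ih (fun j hj => hR j (by omega)) (fun j hj => hL j (by omega))
      (fun v hv => hG v (by omega))
    have h2 : ∀ b, has s i b ↔ has t i b := fun b => by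
      simp [has, hG i (by omega)]
    simp [cl, this, hR (i+1) le_rfl, hL (i+1) le_rfl, h2]

theorem cl_R {s : Tok →₀ ℕ} {i : ℕ} (h : s (R i) ≠ 0) : (cl s i).1 := by
  cases i with
  | zero => exact h
  | succ i => exact Or.inl h

theorem cl_L {s : Tok →₀ ℕ} {i : ℕ} (h : s (L i) ≠ 0) : (cl s i).2 := by
  cases i with
  | zero => exact h
  | succ i => exact Or.inl h

theorem Rel.of_eq {s t : Tok →₀ ℕ} (h : s = t) : Rel s t := h ▸ Rel.refl s

theorem upR {s u : Tok →₀ ℕ} {i k} (h : Rel s (u + (e (G i k true) + e (R i)))) :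
    Rel s (u + (e (G i k false) + e (R (i+1)))) :=
  h.trans ((moveR i k).symm.add u)

theorem upL {s u : Tok →₀ ℕ} {i k} (h : Rel s (u + (e (G i k false) + e (L i)))) :
    Rel s (u + (e (G i k true) + e (L (i+1)))) :=
  h.trans ((moveL i k).add u)

/-- moving a pair up through a nonempty gap. -/
theorem pair_up {u : Tok →₀ ℕ} {i k b} :
    Rel (u + (e (G i k b) + (e (R i) + e (L i))))
      (u + (e (G i k b) + (e (R (i+1)) + e (L (i+1))))) := by
  cases b
  · have h1 := (moveL i k).add (u + e (R i))
    have h2 := (moveR i k).symm.add (u + e (L (i+1)))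
    refine (Rel.of_eq ?_).trans (h1.trans ((Rel.of_eq ?_).trans (h2.trans (Rel.of_eq ?_)))) <;> abel
  · have h1 := (moveR i k).symm.add (u + e (L i))
    have h2 := (moveL i k).add (u + e (R (i+1)))
    refine (Rel.of_eq ?_).trans (h1.trans ((Rel.of_eq ?_).trans (h2.trans (Rel.of_eq ?_)))) <;> abel

theorem realize (i : ℕ) : ∀ s : Tok →₀ ℕ,
    ((cl s i).1 → ∃ u, Rel s (u + e (R i))) ∧
    ((cl s i).2 → ∃ u, Rel s (u + e (L i))) ∧
    ((cl s i).1 → (cl s i).2 → ∃ u, Rel s (u + (e (R i) + e (L i)))) := by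
  induction i with
  | zero =>
    intro s
    refine ⟨fun h => ?_, fun h => ?_, fun h h' => ?_⟩
    · obtain ⟨u, hu⟩ := split1 h; exact ⟨u, Rel.of_eq hu⟩
    · obtain ⟨u, hu⟩ := split1 h; exact ⟨u, Rel.of_eq hu⟩
    · obtain ⟨u, hu⟩ := split2 (by simp) h h'; exact ⟨u, Rel.of_eq hu⟩
  | succ i ih =>
    intro s
    -- removing gap tokens does not affect the closure below
    have rem : ∀ u k b, s = u + e (G i k b) → cl u i = cl s i := by
      rintro u k b rfl
      apply cl_congr
      · intro j _; simp [e]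
      · intro j _; simp [e]
      · intro v hv k' b'
        have : i ≠ v := by omega
        simp [e, Finsupp.single_apply, this]
    have P1 : (cl s i).1 → (cl s i).2 → ∀ b, has s i b →
        ∃ u, Rel s (u + (e (R (i+1)) + e (L (i+1)))) := by
      rintro hr hl b ⟨k, hk⟩
      obtain ⟨u, hu⟩ := split1 hk
      have hc := rem u k b hu
      obtain ⟨y, hy⟩ := (ih u).2.2 (hc ▸ hr) (hc ▸ hl)
      refine ⟨y + e (G i k b), ?_⟩
      have h1 := hy.add (e (G i k b))
      refine (Rel.of_eq (hu.trans (add_comm _ _))).trans (h1.trans ?_)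
      refine (Rel.of_eq ?_).trans ((pair_up (u := y) (i := i) (k := k) (b := b)).trans
        (Rel.of_eq ?_)) <;> abel
    have PR : (cl s i).1 → has s i true → ∃ u, Rel s (u + e (R (i+1))) := by
      rintro hr ⟨k, hk⟩
      obtain ⟨u, hu⟩ := split1 hk
      have hc := rem u k _ hu
      obtain ⟨y, hy⟩ := (ih u).1 (hc ▸ hr)
      refine ⟨y + e (G i k false), ?_⟩
      have h1 := hy.add (e (G i k true))
      refine (Rel.of_eq (hu.trans (add_comm _ _))).trans (h1.trans ?_)
      refine (Rel.of_eq ?_).trans (((moveR i k).symm.add y).trans (Rel.of_eq ?_)) <;> abel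
    have PL : (cl s i).2 → has s i false → ∃ u, Rel s (u + e (L (i+1))) := by
      rintro hr ⟨k, hk⟩
      obtain ⟨u, hu⟩ := split1 hk
      have hc := rem u k _ hu
      obtain ⟨y, hy⟩ := (ih u).2.1 (hc ▸ hr)
      refine ⟨y + e (G i k true), ?_⟩
      have h1 := hy.add (e (G i k false))
      refine (Rel.of_eq (hu.trans (add_comm _ _))).trans (h1.trans ?_)
      refine (Rel.of_eq ?_).trans (((moveL i k).add y).trans (Rel.of_eq ?_)) <;> abel
    have P2 : s (R (i+1)) ≠ 0 → (cl s i).2 → has s i false →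
        ∃ u, Rel s (u + (e (R (i+1)) + e (L (i+1)))) := by
      rintro h0 hr ⟨k, hk⟩
      obtain ⟨u, hu⟩ := split2 (by simp) hk h0
      have hc : cl u i = cl s i := by
        rw [hu]
        apply cl_congr
        · intro j hj
          have : i + 1 ≠ j := by omega
          simp [e, Finsupp.single_apply, this]
        · intro j _; simp [e]
        · intro v hv k' b'
          have : i ≠ v := by omega
          simp [e, Finsupp.single_apply, this]
      obtain ⟨y, hy⟩ := (ih u).2.1 (hc ▸ hr)
      refine ⟨y + e (G i k true), ?_⟩
      have h1 := hy.add (e (G i k false) + e (R (i+1)))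
      refine (Rel.of_eq (hu.trans (add_comm _ _))).trans (h1.trans ?_)
      refine (Rel.of_eq ?_).trans (((moveL i k).add (y + e (R (i+1)))).trans
        (Rel.of_eq ?_)) <;> abel
    have P3 : s (L (i+1)) ≠ 0 → (cl s i).1 → has s i true →
        ∃ u, Rel s (u + (e (R (i+1)) + e (L (i+1)))) := by
      rintro h0 hr ⟨k, hk⟩
      obtain ⟨u, hu⟩ := split2 (by simp) hk h0
      have hc : cl u i = cl s i := by
        rw [hu]
        apply cl_congr
        · intro j _; simp [e]
        · intro j hj
          have : i + 1 ≠ j := by omega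
          simp [e, Finsupp.single_apply, this]
        · intro v hv k' b'
          have : i ≠ v := by omega
          simp [e, Finsupp.single_apply, this]
      obtain ⟨y, hy⟩ := (ih u).1 (hc ▸ hr)
      refine ⟨y + e (G i k false), ?_⟩
      have h1 := hy.add (e (G i k true) + e (L (i+1)))
      refine (Rel.of_eq (hu.trans (add_comm _ _))).trans (h1.trans ?_)
      refine (Rel.of_eq ?_).trans (((moveR i k).symm.add (y + e (L (i+1)))).trans
        (Rel.of_eq ?_)) <;> abel
    have wR : (∃ u, Rel s (u + (e (R (i+1)) + e (L (i+1))))) → ∃ u, Rel s (u + e (R (i+1))) := by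
      rintro ⟨u, hu⟩
      exact ⟨u + e (L (i+1)), hu.trans (Rel.of_eq (by abel))⟩
    have wL : (∃ u, Rel s (u + (e (R (i+1)) + e (L (i+1))))) → ∃ u, Rel s (u + e (L (i+1))) := by
      rintro ⟨u, hu⟩
      exact ⟨u + e (R (i+1)), hu.trans (Rel.of_eq (by abel))⟩
    refine ⟨?_, ?_, ?_⟩
    · rintro (h | ⟨hr, hb | ⟨hl, ha⟩⟩)
      · obtain ⟨u, hu⟩ := split1 h; exact ⟨u, Rel.of_eq hu⟩
      · exact PR hr hb
      · exact wR (P1 hr hl _ ha)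
    · rintro (h | ⟨hl, ha | ⟨hr, hb⟩⟩)
      · obtain ⟨u, hu⟩ := split1 h; exact ⟨u, Rel.of_eq hu⟩
      · exact PL hl ha
      · exact wL (P1 hr hl _ hb)
    · rintro (h | ⟨hr, hb | ⟨hl, ha⟩⟩)
      · rintro (h' | ⟨hl, ha | ⟨hr, hb⟩⟩)
        · obtain ⟨u, hu⟩ := split2 (by simp) h h'; exact ⟨u, Rel.of_eq hu⟩
        · exact P2 h hl ha
        · exact P1 hr hl _ hb
      · rintro (h' | ⟨hl, -⟩)
        · exact P3 h' hr hb
        · exact P1 hr hl _ hb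
      · intro _
        exact P1 hr hl _ ha

/-! ### Normal forms -/

/-- No token can move down and no useful type swap is possible. -/
structure Stuck (t : Tok →₀ ℕ) : Prop where
  hR : ∀ v k, t (G v k false) ≠ 0 → t (R (v+1)) = 0
  hL : ∀ v k, t (G v k true) ≠ 0 → t (L (v+1)) = 0
  hT : ∀ v, t (G v true false) ≠ 0 → t (G v false true) ≠ 0 → ¬ (cl t v).1 ∧ ¬ (cl t v).2

/-- Termination weight. -/
def mw : Tok → ℕ
  | R j => 2 * j
  | L j => 2 * j
  | G _ false true => 1
  | G _ _ _ => 0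

theorem swapR (v : ℕ) : Rel (e (G v true false) + e (G v false true) + e (R v))
    (e (G v true true) + e (G v false false) + e (R v)) := by
  have h1 := (moveR v false).symm.add (e (G v true false))
  have h2 := (moveR v true).add (e (G v false false))
  refine (Rel.of_eq ?_).trans (h1.trans ((Rel.of_eq ?_).trans (h2.trans (Rel.of_eq ?_)))) <;> abel

theorem swapL (v : ℕ) : Rel (e (G v true false) + e (G v false true) + e (L v))
    (e (G v true true) + e (G v false false) + e (L v)) := by
  have h1 := (moveL v true).add (e (G v false true))
  have h2 := (moveL v false).symm.add (e (G v true true))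
  refine (Rel.of_eq ?_).trans (h1.trans ((Rel.of_eq ?_).trans (h2.trans (Rel.of_eq ?_)))) <;> abel

theorem swap_gen {u y a b c : Tok →₀ ℕ} (h : Rel u (y + c)) (hs : Rel (a + c) (b + c)) :
    Rel (u + a) (u + b) := by
  have h1 := h.add a
  have h2 := hs.add y
  have h3 := h.symm.add b
  refine (Rel.of_eq ?_).trans (h1.trans ((Rel.of_eq ?_).trans (h2.trans
    ((Rel.of_eq ?_).trans (h3.trans (Rel.of_eq ?_)))))) <;> abel

theorem exists_stuck (m : ℕ) : ∀ s, W mw s = m → ∃ t, Rel s t ∧ Stuck t := by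
  induction m using Nat.strong_induction_on with
  | _ m ih =>
    intro s hs
    by_cases hst : Stuck s
    · exact ⟨s, Rel.refl s, hst⟩
    have step : ∀ s', Rel s s' → W mw s' < W mw s → ∃ t, Rel s t ∧ Stuck t := by
      intro s' h1 h2
      obtain ⟨t, ht, hst⟩ := ih _ (hs ▸ h2) s' rfl
      exact ⟨t, h1.trans ht, hst⟩
    by_cases hR : ∀ v k, s (G v k false) ≠ 0 → s (R (v+1)) = 0
    swap
    · push Not at hR
      obtain ⟨v, k, h1, h2⟩ := hR
      obtain ⟨u, rfl⟩ := split2 (by simp) h1 h2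
      refine step _ ((moveR v k).add u) ?_
      simp only [W_add, e, W_single]
      cases k <;> simp [mw] <;> omega
    by_cases hL : ∀ v k, s (G v k true) ≠ 0 → s (L (v+1)) = 0
    swap
    · push Not at hL
      obtain ⟨v, k, h1, h2⟩ := hL
      obtain ⟨u, rfl⟩ := split2 (by simp) h1 h2
      refine step _ ((moveL v k).symm.add u) ?_
      simp only [W_add, e, W_single]
      cases k <;> simp [mw] <;> omega
    have hT : ¬ ∀ v, s (G v true false) ≠ 0 → s (G v false true) ≠ 0 →
        ¬ (cl s v).1 ∧ ¬ (cl s v).2 := fun hT => hst ⟨hR, hL, hT⟩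
    push Not at hT
    obtain ⟨v, h1, h2, h3⟩ := hT
    obtain ⟨u, hu⟩ := split2 (by simp) h1 h2
    have hc : cl u v = cl s v := by
      rw [hu]
      apply cl_congr
      · intro j _; simp [e]
      · intro j _; simp [e]
      · intro v' hv k' b'
        have : v ≠ v' := by omega
        simp [e, Finsupp.single_apply, this]
    have hrel : Rel s (u + (e (G v true true) + e (G v false false))) := by
      rw [← hc] at h3
      refine (Rel.of_eq hu).trans ?_
      by_cases hr : (cl u v).1
      · obtain ⟨y, hy⟩ := (realize v u).1 hr
        exact swap_gen hy (swapR v)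
      · obtain ⟨y, hy⟩ := (realize v u).2.1 (h3 hr)
        exact swap_gen hy (swapL v)
    refine step _ hrel ?_
    rw [hu]
    simp only [W_add, e, W_single]
    simp [mw]

/-! ### Uniqueness of normal forms -/

theorem types_le {s t : Tok →₀ ℕ} (hs : Stuck s) (h : ev s = ev t)
    (hR : ∀ j, s (R j) = t (R j)) (hL : ∀ j, s (L j) = t (L j))
    (hN : ∀ v k, s (G v k false) + s (G v k true) = t (G v k false) + t (G v k true))
    (hB : ∀ v, s (G v false true) + s (G v true true) = t (G v false true) + t (G v true true))
    (v : ℕ) : s (G v false true) ≤ t (G v false true) := by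
  by_contra hlt
  have hN0 := hN v false
  have hN1 := hN v true
  have hBv := hB v
  have hα : s (G v true false) ≠ 0 := by omega
  have hβ : s (G v false true) ≠ 0 := by omega
  obtain ⟨nr, nl⟩ := hs.hT v hα hβ
  have hR1 := hs.hR v _ hα
  have hL1 := hs.hL v _ hβ
  have nr1 : ¬ (cl s (v+1)).1 := by simp [cl, hR1, nr]
  have nl1 : ¬ (cl s (v+1)).2 := by simp [cl, hL1, nl]
  let act : ℕ → Prop := fun i => ((cl s i).1 ∧ has s i true) ∨ ((cl s i).2 ∧ has s i false)
  let F : Tok → Prop := fun x => match x with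
    | R i => (cl s i).1
    | L i => (cl s i).2
    | G i _ b => has s i b ∨ act i
  have hasR : ∀ i, s (R (i+1)) ≠ 0 → ¬ has s i false := by
    rintro i hi ⟨k, hk⟩; exact hi (hs.hR i k hk)
  have hasL : ∀ i, s (L (i+1)) ≠ 0 → ¬ has s i true := by
    rintro i hi ⟨k, hk⟩; exact hi (hs.hL i k hk)
  have hst : ∀ i b, has t i b → has s i b := by
    rintro i b ⟨k, hk⟩
    have a1 := hN i false
    have a2 := hN i true
    have a3 := hB i
    by_contra hcon
    simp only [has, not_exists, not_not] at hcon
    have b1 := hcon false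
    have b2 := hcon true
    cases b <;> cases k <;> omega
  have := char_eq F (fun i => if i = G v false true then 1 else 0) ?_ ?_ ?_ ?_
    (s := s) (t := t) ?_ ?_ h
  · rw [W_ind, W_ind] at this; omega
  · intro i k
    have := hasR i
    simp only [F, act, cl]
    tauto
  · intro i k
    have := hasL i
    simp only [F, act, cl]
    tauto
  · intro i k _ h2
    have : i ≠ v := by rintro rfl; exact nr1 h2
    simp [this]
  · intro i k _ h2
    have : i ≠ v := by rintro rfl; exact nl h2
    simp [this]
  · rintro (j | j | ⟨i, k, b⟩) hx
    · exact cl_R hx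
    · exact cl_L hx
    · exact Or.inl ⟨k, hx⟩
  · rintro (j | j | ⟨i, k, b⟩) hx
    · exact cl_R ((hR j).trans_ne hx)
    · exact cl_L ((hL j).trans_ne hx)
    · exact Or.inl (hst i b ⟨k, hx⟩)

/-- weight of `R` tokens above row `v` -/
def tR (v : ℕ) : Tok → ℕ
  | R j => if v < j then 1 else 0
  | _ => 0
/-- weight of `L` tokens above row `v` -/
def tL (v : ℕ) : Tok → ℕ
  | L j => if v < j then 1 else 0
  | _ => 0
/-- weight of `L` tokens up to row `v` -/
def hdL (v : ℕ) : Tok → ℕ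
  | L j => if v < j then 0 else 1
  | _ => 0
/-- weight of all `R` tokens -/
def aR : Tok → ℕ
  | R _ => 1
  | _ => 0
/-- weight of all `L` tokens -/
def aL : Tok → ℕ
  | L _ => 1
  | _ => 0

theorem tR_succ (v s) : W (tR v) s = W (tR (v+1)) s + s (R (v+1)) := by
  rw [← W_ind (R (v+1)), ← W_fadd]
  congr 1; funext x
  rcases x with j | j | ⟨i, k, b⟩ <;> simp [tR]
  split_ifs <;> omega

theorem tL_succ (v s) : W (tL v) s = W (tL (v+1)) s + s (L (v+1)) := by
  rw [← W_ind (L (v+1)), ← W_fadd]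
  congr 1; funext x
  rcases x with j | j | ⟨i, k, b⟩ <;> simp [tL]
  split_ifs <;> omega

theorem aR_eq (s) : W aR s = W (tR 0) s + s (R 0) := by
  rw [← W_ind (R 0), ← W_fadd]
  congr 1; funext x
  rcases x with j | j | ⟨i, k, b⟩ <;> simp [tR, aR]
  split_ifs <;> omega

theorem aL_eq (s) : W aL s = W (tL 0) s + s (L 0) := by
  rw [← W_ind (L 0), ← W_fadd]
  congr 1; funext x
  rcases x with j | j | ⟨i, k, b⟩ <;> simp [tL, aL]
  split_ifs <;> omega

theorem aL_split (v s) : W aL s = W (tL v) s + W (hdL v) s := by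
  rw [← W_fadd]
  congr 1; funext x
  rcases x with j | j | ⟨i, k, b⟩ <;> simp [tL, aL, hdL]
  split_ifs <;> omega

theorem inv_N {s t : Tok →₀ ℕ} (h : ev s = ev t) (v k) :
    s (G v k false) + s (G v k true) = t (G v k false) + t (G v k true) := by
  rw [← W_ind (G v k false) s, ← W_ind (G v k false) t, ← W_ind (G v k true) s,
    ← W_ind (G v k true) t, ← W_fadd, ← W_fadd]
  refine char_full _ ?_ ?_ h <;> intro i k' <;> simp

theorem inv_C {s t : Tok →₀ ℕ} (h : ev s = ev t) (v) :
    W (tR v) s + W (hdL v) s + (s (G v false true) + s (G v true true)) =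
    W (tR v) t + W (hdL v) t + (t (G v false true) + t (G v true true)) := by
  rw [← W_ind (G v false true) s, ← W_ind (G v false true) t, ← W_ind (G v true true) s,
    ← W_ind (G v true true) t, ← W_fadd, ← W_fadd, ← W_fadd, ← W_fadd, ← W_fadd, ← W_fadd]
  refine char_full _ ?_ ?_ h <;> intro i k' <;> cases k' <;> simp [tR, hdL] <;>
    split_ifs <;> omega

theorem inv_aR {s t : Tok →₀ ℕ} (h : ev s = ev t) : W aR s = W aR t := by
  refine char_full _ ?_ ?_ h <;> intro i k' <;> simp [aR]

theorem inv_aL {s t : Tok →₀ ℕ} (h : ev s = ev t) : W aL s = W aL t := by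
  refine char_full _ ?_ ?_ h <;> intro i k' <;> simp [aL]

theorem inv_cut {s t : Tok →₀ ℕ} (h : ev s = ev t) (v : ℕ) (w : Tok → ℕ)
    (hw : w = tR v ∨ w = tL v)
    (hs : ∀ k b, s (G v k b) = 0) (ht : ∀ k b, t (G v k b) = 0) : W w s = W w t := by
  let F : Tok → Prop := fun x => match x with
    | G i _ _ => i ≠ v
    | _ => True
  refine char_eq F w ?_ ?_ ?_ ?_ ?_ ?_ h
  · intro i k; simp [F]
  · intro i k; simp [F]
  · intro i k h1 _
    have h1 : i ≠ v := h1
    rcases hw with rfl | rfl <;> simp [tR, tL]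
    split_ifs <;> omega
  · intro i k h1 _
    have h1 : i ≠ v := h1
    rcases hw with rfl | rfl <;> simp [tR, tL]
    split_ifs <;> omega
  · rintro (j | j | ⟨i, k, b⟩) hx
    · trivial
    · trivial
    · rintro rfl; exact hx (hs k b)
  · rintro (j | j | ⟨i, k, b⟩) hx
    · trivial
    · trivial
    · rintro rfl; exact hx (ht k b)

theorem tails_eventually (s : Tok →₀ ℕ) : ∃ N, ∀ v, N ≤ v → W (tR v) s = 0 ∧ W (tL v) s = 0 := by
  let idx : Tok → ℕ := fun x => match x with
    | R j => j
    | L j => j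
    | G _ _ _ => 0
  refine ⟨s.support.sup idx, fun v hv => ⟨W_zero ?_, W_zero ?_⟩⟩
  · intro i hi
    have : idx i ≤ v := le_trans (Finset.le_sup (f := idx) (by simpa using hi)) hv
    rcases i with j | j | ⟨i, k, b⟩ <;> simp [tR]
    simpa [idx] using this
  · intro i hi
    have : idx i ≤ v := le_trans (Finset.le_sup (f := idx) (by simpa using hi)) hv
    rcases i with j | j | ⟨i, k, b⟩ <;> simp [tL]
    simpa [idx] using this

theorem tails_step {s t : Tok →₀ ℕ} (hs : Stuck s) (ht : Stuck t) (h : ev s = ev t) (v : ℕ)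
    (h1 : W (tR (v+1)) s = W (tR (v+1)) t) (h2 : W (tL (v+1)) s = W (tL (v+1)) t) :
    W (tR v) s = W (tR v) t ∧ W (tL v) s = W (tL v) t := by
  have a1 := tR_succ v s
  have a2 := tR_succ v t
  have a3 := tL_succ v s
  have a4 := tL_succ v t
  have b1 := aL_split v s
  have b2 := aL_split v t
  have b3 := inv_aL h
  have c := inv_C h v
  have n0 := inv_N h v false
  have n1 := inv_N h v true
  have r0 := hs.hR v false
  have r1 := hs.hR v true
  have r2 := ht.hR v false
  have r3 := ht.hR v true
  have l0 := hs.hL v false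
  have l1 := hs.hL v true
  have l2 := ht.hL v false
  have l3 := ht.hL v true
  by_cases hN : s (G v false false) = 0 ∧ s (G v false true) = 0 ∧
      s (G v true false) = 0 ∧ s (G v true true) = 0
  · obtain ⟨z1, z2, z3, z4⟩ := hN
    have hs0 : ∀ k b, s (G v k b) = 0 := by
      intro k b; cases k <;> cases b <;> assumption
    have ht0 : ∀ k b, t (G v k b) = 0 := by
      intro k b; cases k <;> cases b <;> omega
    exact ⟨inv_cut h v _ (Or.inl rfl) hs0 ht0, inv_cut h v _ (Or.inr rfl) hs0 ht0⟩
  · constructor <;> by_contra hne <;> omega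

theorem stuck_unique {s t : Tok →₀ ℕ} (hs : Stuck s) (ht : Stuck t) (h : ev s = ev t) :
    s = t := by
  have tails : ∀ v, W (tR v) s = W (tR v) t ∧ W (tL v) s = W (tL v) t := by
    obtain ⟨N, hN⟩ := tails_eventually s
    obtain ⟨N', hN'⟩ := tails_eventually t
    have : ∀ d v, N + N' ≤ v + d → W (tR v) s = W (tR v) t ∧ W (tL v) s = W (tL v) t := by
      intro d
      induction d with
      | zero =>
        intro v hv
        have x1 := hN v (by omega)
        have x2 := hN' v (by omega)
        omega
      | succ d ih =>
        intro v hv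
        have := ih (v+1) (by omega)
        exact tails_step hs ht h v this.1 this.2
    exact fun v => this (N + N') v (by omega)
  have hR : ∀ j, s (R j) = t (R j) := by
    intro j
    cases j with
    | zero =>
      have := aR_eq s; have := aR_eq t; have := inv_aR h; have := (tails 0).1
      omega
    | succ j =>
      have := tR_succ j s; have := tR_succ j t; have := (tails j).1; have := (tails (j+1)).1
      omega
  have hL : ∀ j, s (L j) = t (L j) := by
    intro j
    cases j with
    | zero =>
      have := aL_eq s; have := aL_eq t; have := inv_aL h; have := (tails 0).2
      omega
    | succ j =>
      have := tL_succ j s; have := tL_succ j t; have := (tails j).2; have := (tails (j+1)).2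
      omega
  have hB : ∀ v, s (G v false true) + s (G v true true)
      = t (G v false true) + t (G v true true) := by
    intro v
    have := inv_C h v
    have := tails v
    have b1 := aL_split v s
    have b2 := aL_split v t
    have b3 := inv_aL h
    omega
  have hN := inv_N h
  have l1 := types_le hs h hR hL hN hB
  have l2 := types_le ht h.symm (fun j => (hR j).symm) (fun j => (hL j).symm)
    (fun v k => (hN v k).symm) (fun v => (hB v).symm)
  ext x
  rcases x with j | j | ⟨v, k, b⟩
  · exact hR j
  · exact hL j
  · have := l1 v
    have := l2 v
    have := hN v false
    have := hN v true
    have := hB v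
    cases k <;> cases b <;> omega

theorem tIdeal_radical : tIdeal.IsRadical := by
  refine radical_of fun s t h => ?_
  obtain ⟨s', hs, hs'⟩ := exists_stuck _ s rfl
  obtain ⟨t', ht, ht'⟩ := exists_stuck _ t rfl
  have : s' = t' := stuck_unique hs' ht' (hs.ev_eq.symm.trans (h.trans ht.ev_eq))
  subst this
  exact hs.trans ht.symm

/-! ### Comparison with the grid ideal -/

/-- token of a grid variable -/
def ofName : BDName → Tok
  | .R _ j => R j
  | .L _ j => L j
  | .U 0 j => G j false false
  | .U (_+1) j => G j false true
  | .D 0 j => G (j-1) true true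
  | .D (_+1) j => G (j-1) true false

/-- polynomial of a token, zero when out of range -/
noncomputable def toPoly (n : ℕ) : Tok → MvPolynomial (BDVars 1 n) ℚ
  | R j => if h : j ≤ n then X ⟨.R 0 j, Nat.one_pos, h⟩ else 0
  | L j => if h : j ≤ n then X ⟨.L 1 j, Nat.one_pos, le_rfl, h⟩ else 0
  | G v false false => if h : v < n then X ⟨.U 0 v, Nat.zero_le _, h⟩ else 0
  | G v false true => if h : v < n then X ⟨.U 1 v, le_rfl, h⟩ else 0
  | G v true false => if h : v < n then X ⟨.D 1 (v+1), le_rfl, v.succ_pos, h⟩ else 0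
  | G v true true => if h : v < n then X ⟨.D 0 (v+1), Nat.zero_le _, v.succ_pos, h⟩ else 0

theorem toPoly_ofName (n : ℕ) (x : BDVars 1 n) : toPoly n (ofName x) = X x := by
  obtain ⟨x, hx⟩ := x
  rcases x with ⟨i, j⟩ | ⟨i, j⟩ | ⟨i, j⟩ | ⟨i, j⟩
  · obtain ⟨h1, h2⟩ : i < 1 ∧ j ≤ n := hx
    obtain rfl : i = 0 := by omega
    simp [ofName, toPoly, h2]
  · obtain ⟨h0, h1, h2⟩ : 0 < i ∧ i ≤ 1 ∧ j ≤ n := hx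
    obtain rfl : i = 1 := by omega
    simp [ofName, toPoly, h2]
  · obtain ⟨h0, h1, h2⟩ : i ≤ 1 ∧ 0 < j ∧ j ≤ n := hx
    obtain ⟨j, rfl⟩ : ∃ j', j = j' + 1 := ⟨j - 1, by omega⟩
    have h3 : j < n := h2
    obtain rfl | rfl : i = 0 ∨ i = 1 := by omega
    · simp [ofName, toPoly, h3]
    · simp [ofName, toPoly, h3]
  · obtain ⟨h0, h1⟩ : i ≤ 1 ∧ j < n := hx
    obtain rfl | rfl : i = 0 ∨ i = 1 := by omega
    · simp [ofName, toPoly, h1]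
    · simp [ofName, toPoly, h1]

theorem incl_le (n : ℕ) : cbdIdeal 1 n ≤
    tIdeal.comap (rename (fun x : BDVars 1 n => ofName x) : _ →ₐ[ℚ] MvPolynomial Tok ℚ) := by
  refine Ideal.span_le.2 ?_
  rintro f ⟨u, v, hu, hv, hf⟩
  obtain rfl : u = 0 := by omega
  have gR : ∀ k, X (G v k false) * X (R (v+1)) - X (G v k true) * X (R v) ∈ tIdeal :=
    fun k => Ideal.subset_span ⟨v, k, Or.inl rfl⟩
  have gL : ∀ k, X (G v k false) * X (L v) - X (G v k true) * X (L (v+1)) ∈ tIdeal :=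
    fun k => Ideal.subset_span ⟨v, k, Or.inr rfl⟩
  rw [SetLike.mem_coe, Ideal.mem_comap]
  rcases hf with rfl | rfl | rfl | rfl
  · simp only [map_sub, map_mul, rename_X, ofName]
    convert gR false using 1; ring
  · simp only [map_sub, map_mul, rename_X, ofName, Nat.add_sub_cancel]
    convert tIdeal.neg_mem (gR true) using 1; ring
  · simp only [map_sub, map_mul, rename_X, ofName, Nat.add_sub_cancel]
    convert tIdeal.neg_mem (gL true) using 1; ring
  · simp only [map_sub, map_mul, rename_X, ofName]
    convert gL false using 1; ring

theorem retr_le (n : ℕ) : tIdeal ≤ (cbdIdeal 1 n).comap (aeval (R := ℚ) (toPoly n)) := by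
  refine Ideal.span_le.2 ?_
  rintro f ⟨v, k, hf⟩
  rw [SetLike.mem_coe, Ideal.mem_comap]
  by_cases hv : v < n
  · have hv' : v + 1 ≤ n := hv
    rcases hf with rfl | rfl <;> cases k <;>
      simp only [map_sub, map_mul, aeval_X, toPoly, dif_pos hv, dif_pos hv', dif_pos hv.le]
    · exact Ideal.subset_span ⟨0, v, Nat.one_pos, hv, Or.inl (by ring)⟩
    · rw [← neg_mem_iff]
      exact Ideal.subset_span ⟨0, v, Nat.one_pos, hv, Or.inr (Or.inl (by ring))⟩
    · exact Ideal.subset_span ⟨0, v, Nat.one_pos, hv, Or.inr (Or.inr (Or.inr (by ring)))⟩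
    · rw [← neg_mem_iff]
      exact Ideal.subset_span ⟨0, v, Nat.one_pos, hv, Or.inr (Or.inr (Or.inl (by ring)))⟩
  · rcases hf with rfl | rfl <;> cases k <;> simp [toPoly, hv]

theorem radical_all (n : ℕ) : (cbdIdeal 1 n).IsRadical := by
  rintro f ⟨m, hm⟩
  have h1 := incl_le n hm
  rw [Ideal.mem_comap, map_pow] at h1
  have h2 := retr_le n (tIdeal_radical ⟨m, h1⟩)
  rw [Ideal.mem_comap] at h2
  have : aeval (R := ℚ) (toPoly n) (rename (fun x : BDVars 1 n => ofName x) f) = f := by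
    rw [aeval_rename]
    have : (toPoly n ∘ fun x : BDVars 1 n => ofName x) = X := funext (toPoly_ofName n)
    rw [this, aeval_X_left_apply]
  rwa [this] at h2

end Tok

/-- The commuting birth and death ideals `I^{(1,n)}` for `n = 1, …, 6` are radical. -/
theorem cbdIdeal_one_n_radical :
    ∀ n : ℕ, 1 ≤ n → n ≤ 6 → (cbdIdeal 1 n).IsRadical :=
  fun n _ _ => Tok.radical_all n
end
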